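/- arXiv:2205.08612 — 2 statements merged into one kernel-verified Lean document; each statement's English description precedes it below -/
import Mathlib

section
/- Let Ω ⊂ ℝⁿ be a bounded open set and let p : Ω → ℝ be C¹ with 1 < p⁻ := inf_Ω p ≤ sup_Ω p =: p⁺ < ∞, and assume that either p⁻ ≥ 2 or p⁺ < 2. If u : Ω → ℝ is bounded, locally Lipschitz, and a viscosity supersolution of −Δ_{p(·)}u = 0 in Ω, then for every nonnegative smooth function ψ with compact support in Ω one has ∫_Ω |Du(x)|^{p(x)−2} ⟨Du(x), Dψ(x)⟩ dx ≥ 0, where Du denotes the almost-everywhere defined gradient of u and the integrand is taken to be 0 at points where Du(x) = 0. -/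
open MeasureTheory Metric Set Filter Asymptotics
open scoped RealInnerProductSpace NNReal Topology

noncomputable section

abbrev En (n : ℕ) := EuclideanSpace ℝ (Fin n)

/-- The nondivergence-form `p(·)`-Laplacian `-Δ_{p(·)} φ` at `x`. -/
noncomputable def negPLap {n : ℕ} (p φ : En n → ℝ) (x : En n) : ℝ :=
  -(‖gradient φ x‖ ^ (p x - 2) *
      LinearMap.trace ℝ (En n) (fderiv ℝ (gradient φ) x : En n →ₗ[ℝ] En n))
  - (p x - 2) * ‖gradient φ x‖ ^ (p x - 4) *
      ⟪fderiv ℝ (gradient φ) x (gradient φ x), gradient φ x⟫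
  - ‖gradient φ x‖ ^ (p x - 2) * Real.log ‖gradient φ x‖ *
      ⟪gradient p x, gradient φ x⟫

/-- `u` is a viscosity supersolution of `-Δ_{p(·)} u = 0` on an open set `D`. -/
def IsViscositySupersolution {n : ℕ} (p u : En n → ℝ) (D : Set (En n)) : Prop :=
  ∀ x₀ ∈ D, ∀ φ : En n → ℝ,
    ContDiffAt ℝ 2 φ x₀ → φ x₀ = u x₀ →
    (∀ᶠ x in 𝓝[≠] x₀, φ x < u x) →
    gradient φ x₀ ≠ 0 → 0 ≤ negPLap p φ x₀

/-- The infimal convolution `u_ε` of `u`. -/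
noncomputable def infConv {n : ℕ} (u : En n → ℝ) (Ω : Set (En n)) (q ε : ℝ) (x : En n) : ℝ :=
  sInf ((fun y => u y + ‖x - y‖ ^ q / (q * ε ^ (q - 1))) '' Ω)

/-- `r(ε) = (q ε^{q-1} (M - m))^{1/q}` where `M = sup u`, `m = inf u`. -/
noncomputable def rEps {n : ℕ} (u : En n → ℝ) (Ω : Set (En n)) (q ε : ℝ) : ℝ :=
  (q * ε ^ (q - 1) * (sSup (u '' Ω) - sInf (u '' Ω))) ^ (1 / q)

/-- `Ω_r = {x ∈ Ω : dist(x, ∂Ω) > r}`. -/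
def innerSet {n : ℕ} (Ω : Set (En n)) (r : ℝ) : Set (En n) :=
  {x ∈ Ω | r < Metric.infDist x (frontier Ω)}

/-- The set of minimizers `Y_ε(x)`. -/
def Yset {n : ℕ} (u : En n → ℝ) (Ω : Set (En n)) (q ε : ℝ) (x : En n) : Set (En n) :=
  {y ∈ Ω | infConv u Ω q ε x = u y + ‖x - y‖ ^ q / (q * ε ^ (q - 1))}

/-- `f` is locally Lipschitz on `s`. -/
def LocLipschitzOn {n : ℕ} (f : En n → ℝ) (s : Set (En n)) : Prop :=
  ∀ x ∈ s, ∃ K : ℝ≥0, ∃ t ∈ 𝓝[s] x, LipschitzOnWith K f t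

open Classical in
/-- `|Du(x)|^{p(x)-2} ⟨Du(x), Dψ(x)⟩`, taken to be `0` where `Du(x) = 0`. -/
noncomputable def weakIntegrand {n : ℕ} (p u ψ : En n → ℝ) (x : En n) : ℝ :=
  if gradient u x = 0 then 0
  else ‖gradient u x‖ ^ (p x - 2) * ⟪gradient u x, gradient ψ x⟫

section InfConvolution

variable {E : Type*} [NormedAddCommGroup E] [InnerProductSpace ℝ E] [FiniteDimensional ℝ E]

/-- A Lipschitz function has an infimal convolution with any superlinear kernel; the infimum is
attained, and the Lipschitz constant is preserved. -/
theorem exists_infConvolution {L : ℝ≥0} {g κ : E → ℝ} (hg : LipschitzWith L g)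
    (hκ : Continuous κ) (hκ0 : κ 0 = 0) {R : ℝ} (hR0 : 0 ≤ R)
    (hR : ∀ z, R < ‖z‖ → L * ‖z‖ < κ z) :
    ∃ w : E → ℝ, LipschitzWith L w ∧ (∀ x y, w x ≤ g y + κ (x - y)) ∧
      ∀ x, ∃ y, ‖x - y‖ ≤ R ∧ w x = g y + κ (x - y) := by
  have key : ∀ x, ∃ y, ‖x - y‖ ≤ R ∧ ∀ y', g y + κ (x - y) ≤ g y' + κ (x - y') := by
    intro x
    obtain ⟨y, hy, hmin⟩ := (isCompact_closedBall x R).exists_isMinOn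
      ⟨x, mem_closedBall_self hR0⟩
      (f := fun y => g y + κ (x - y)) (by
        have := hg.continuous
        fun_prop)
    refine ⟨y, by rwa [mem_closedBall, dist_comm, dist_eq_norm] at hy, fun y' => ?_⟩
    by_cases h : ‖x - y'‖ ≤ R
    · exact hmin (by rwa [mem_closedBall, dist_comm, dist_eq_norm])
    · have h1 := hR _ (not_le.mp h)
      have h2 : g y + κ (x - y) ≤ g x + κ (x - x) := hmin (mem_closedBall_self hR0)
      have h3 := hg.dist_le_mul x y'
      rw [dist_eq_norm, dist_eq_norm, Real.norm_eq_abs] at h3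
      have h4 := le_abs_self (g x - g y')
      rw [sub_self, hκ0] at h2
      linarith
  choose Y hYR hY using key
  refine ⟨fun x => g (Y x) + κ (x - Y x), ?_, fun x y => hY x y, fun x => ⟨Y x, hYR x, rfl⟩⟩
  refine LipschitzWith.of_le_add_mul L fun x x' => ?_
  have h1 := hY x (Y x' + (x - x'))
  have h3 := hg.dist_le_mul (Y x' + (x - x')) (Y x')
  rw [dist_eq_norm, Real.norm_eq_abs, dist_eq_norm, add_sub_cancel_left, ← dist_eq_norm] at h3
  have h4 := le_abs_self (g (Y x' + (x - x')) - g (Y x'))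
  rw [show x - (Y x' + (x - x')) = x' - Y x' by abel] at h1
  linarith

end InfConvolution

section Kernel

theorem pow_le_taylor_two {a b T : ℝ} (ha : 0 ≤ a) (hb : 0 ≤ b) (haT : a ≤ T) (hbT : b ≤ T)
    (j : ℕ) :
    b ^ (j + 2) ≤ a ^ (j + 2) + (j + 2) * a ^ (j + 1) * (b - a)
      + (j + 2) ^ 2 * T ^ j * (b - a) ^ 2 := by
  induction j with
  | zero => norm_num; nlinarith [sq_nonneg (b - a)]
  | succ j ih =>
    have h1 := mul_le_mul_of_nonneg_left ih hb
    have hT : 0 ≤ T := ha.trans haT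
    have h2 : a ^ (j + 1) ≤ T ^ (j + 1) := by gcongr
    have h3 : b * T ^ j ≤ T ^ (j + 1) := by
      rw [pow_succ']; gcongr
    have hTj : 0 ≤ T ^ (j + 1) := by positivity
    have e1 := mul_le_mul_of_nonneg_right h2 (sq_nonneg (b - a))
    have e2 := mul_le_mul_of_nonneg_right h3 (sq_nonneg (b - a))
    have hj : (0 : ℝ) ≤ j + 2 := by positivity
    have e3 := mul_le_mul_of_nonneg_left e1 hj
    have e4 := mul_le_mul_of_nonneg_left e2 (sq_nonneg ((j : ℝ) + 2))
    have e5 : 0 ≤ T ^ (j + 1) * (b - a) ^ 2 := by positivity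
    push_cast
    calc b ^ (j + 1 + 2) = b * b ^ (j + 2) := by ring
      _ ≤ _ := h1
      _ ≤ _ := by
        have : b * (a ^ (j + 2) + (j + 2) * a ^ (j + 1) * (b - a)
            + (j + 2) ^ 2 * T ^ j * (b - a) ^ 2)
            = a ^ (j + 1 + 2) + (j + 1 + 2) * a ^ (j + 1 + 1) * (b - a)
              + (j + 2) * (a ^ (j + 1) * (b - a) ^ 2)
              + (j + 2) ^ 2 * (b * T ^ j * (b - a) ^ 2) := by ring
        rw [this]
        have hj0 : (0 : ℝ) ≤ j := by positivity
        nlinarith [mul_nonneg hj0 e5]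

variable {E : Type*} [NormedAddCommGroup E]

/-- The even power kernel `c |z|^(2 * j + 4)`. -/
def powKernel (c : ℝ) (j : ℕ) (z : E) : ℝ := c * (‖z‖ ^ 2) ^ (j + 2)

theorem continuous_powKernel (c : ℝ) (j : ℕ) : Continuous (powKernel (E := E) c j) := by
  unfold powKernel; fun_prop

theorem powKernel_zero (c : ℝ) (j : ℕ) : powKernel (E := E) c j 0 = 0 := by
  simp [powKernel]

variable [InnerProductSpace ℝ E]

/-- The gradient of `powKernel`. -/
def powKernelGrad (c : ℝ) (j : ℕ) (z : E) : E := (2 * (j + 2) * c * (‖z‖ ^ 2) ^ (j + 1)) • z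

theorem powKernel_add_le {c : ℝ} (hc : 0 ≤ c) (j : ℕ) (z e : E) :
    powKernel c j (z + e) ≤ powKernel c j z + ⟪powKernelGrad c j z, e⟫
      + 5 * (j + 2) ^ 2 * c * ((‖z‖ + ‖e‖) ^ 2) ^ (j + 1) * ‖e‖ ^ 2 := by
  have hexp : ‖z + e‖ ^ 2 - ‖z‖ ^ 2 = 2 * ⟪z, e⟫ + ‖e‖ ^ 2 := by
    rw [norm_add_sq_real]; ring
  set T := (‖z‖ + ‖e‖) ^ 2 with hT
  have hT0 : 0 ≤ T := by positivity
  have hzT : ‖z‖ ^ 2 ≤ T := by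
    rw [hT]; gcongr; linarith [norm_nonneg e]
  have hzeT : ‖z + e‖ ^ 2 ≤ T := by
    rw [hT]; gcongr; exact norm_add_le z e
  have h1 := pow_le_taylor_two (sq_nonneg ‖z‖) (sq_nonneg ‖z + e‖) hzT hzeT j
  rw [hexp] at h1
  have hin : |⟪z, e⟫| ≤ ‖z‖ * ‖e‖ := abs_real_inner_le_norm z e
  have hsq : (2 * ⟪z, e⟫ + ‖e‖ ^ 2) ^ 2 ≤ 4 * T * ‖e‖ ^ 2 := by
    have : |2 * ⟪z, e⟫ + ‖e‖ ^ 2| ≤ 2 * (‖z‖ + ‖e‖) * ‖e‖ := by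
      rw [abs_le] at hin ⊢
      constructor <;> nlinarith [norm_nonneg z, norm_nonneg e,
        mul_nonneg (norm_nonneg z) (norm_nonneg e), sq_nonneg ‖e‖]
    calc _ = |2 * ⟪z, e⟫ + ‖e‖ ^ 2| ^ 2 := (sq_abs _).symm
      _ ≤ (2 * (‖z‖ + ‖e‖) * ‖e‖) ^ 2 := by gcongr
      _ = _ := by rw [hT]; ring
  have h2 : T ^ j * (2 * ⟪z, e⟫ + ‖e‖ ^ 2) ^ 2 ≤ 4 * T ^ (j + 1) * ‖e‖ ^ 2 := by
    calc _ ≤ T ^ j * (4 * T * ‖e‖ ^ 2) := by gcongr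
      _ = _ := by ring
  have h3 : (‖z‖ ^ 2) ^ (j + 1) * ‖e‖ ^ 2 ≤ T ^ (j + 1) * ‖e‖ ^ 2 := by gcongr
  have h4 : ((j : ℝ) + 2) * (T ^ (j + 1) * ‖e‖ ^ 2) ≤ (j + 2) ^ 2 * (T ^ (j + 1) * ‖e‖ ^ 2) := by
    have : (0 : ℝ) ≤ j := by positivity
    gcongr; nlinarith
  have hj : (0 : ℝ) ≤ j + 2 := by positivity
  have h5 : (‖z + e‖ ^ 2) ^ (j + 2) ≤ (‖z‖ ^ 2) ^ (j + 2)
      + 2 * (j + 2) * (‖z‖ ^ 2) ^ (j + 1) * ⟪z, e⟫ + 5 * (j + 2) ^ 2 * T ^ (j + 1) * ‖e‖ ^ 2 := by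
    have := mul_le_mul_of_nonneg_left h2 (sq_nonneg ((j : ℝ) + 2))
    have := mul_le_mul_of_nonneg_left h3 hj
    nlinarith
  have h6 := mul_le_mul_of_nonneg_left h5 hc
  unfold powKernel powKernelGrad
  rw [real_inner_smul_left]
  linarith

theorem norm_powKernelGrad {c : ℝ} (hc : 0 ≤ c) (j : ℕ) (z : E) :
    ‖powKernelGrad c j z‖ = 2 * (j + 2) * c * ‖z‖ ^ (2 * j + 3) := by
  rw [powKernelGrad, norm_smul, Real.norm_eq_abs, abs_of_nonneg (by positivity), ← pow_mul]
  ring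

end Kernel

section Hull

variable {E : Type*} [NormedAddCommGroup E] [InnerProductSpace ℝ E]

/-- A function with locally uniform quadratic two-sided Taylor bounds has a Lipschitz gradient,
provided the gradient is bounded. -/
theorem lipschitzWith_of_quadratic_bound {v : E → ℝ} {G : E → E} {C B : ℝ} (hC : 0 ≤ C)
    (hB : ∀ x, ‖G x‖ ≤ B)
    (hq : ∀ x h, ‖h‖ ≤ 1 → |v (x + h) - v x - ⟪G x, h⟫| ≤ C * ‖h‖ ^ 2) :
    ∃ D : ℝ≥0, LipschitzWith D G := by
  have hB0 : 0 ≤ B := (norm_nonneg _).trans (hB 0)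
  refine ⟨⟨6 * C + 4 * B, by positivity⟩, LipschitzWith.of_dist_le_mul fun y x => ?_⟩
  rw [dist_eq_norm, dist_eq_norm]
  change ‖G y - G x‖ ≤ (6 * C + 4 * B) * ‖y - x‖
  by_cases hd : ‖y - x‖ ≤ 1 / 2
  · by_cases h0 : G y - G x = 0
    · rw [h0, norm_zero]; positivity
    have hn : 0 < ‖G y - G x‖ := norm_pos_iff.mpr h0
    set d := y - x with hdd
    set e : E := (‖d‖ / ‖G y - G x‖) • (G y - G x) with he
    have hen : ‖e‖ = ‖d‖ := by
      rw [he, norm_smul, norm_div, norm_norm, norm_norm]; field_simp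
    have hde : ‖d + e‖ ≤ 2 * ‖d‖ := (norm_add_le _ _).trans (by rw [hen]; linarith)
    have h1 := abs_le.mp (hq y e (by linarith))
    have h2 := abs_le.mp (hq x (d + e) (by linarith))
    have h3 := abs_le.mp (hq x d (by linarith))
    have hy : x + d = y := by rw [hdd]; abel
    rw [← add_assoc, hy, inner_add_right] at h2
    rw [hy] at h3
    rw [hen] at h1
    have h4 : C * ‖d + e‖ ^ 2 ≤ C * (4 * ‖d‖ ^ 2) := by
      gcongr; nlinarith [norm_nonneg (d + e), norm_nonneg d]
    have h5 : ⟪G y, e⟫ - ⟪G x, e⟫ = ‖d‖ * ‖G y - G x‖ := by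
      rw [← inner_sub_left, he, real_inner_smul_right, real_inner_self_eq_norm_sq]; field_simp
    have h6 : ‖d‖ * ‖G y - G x‖ ≤ ‖d‖ * (6 * C * ‖d‖) := by
      rw [← h5]; nlinarith [h1.1, h1.2, h2.1, h2.2, h3.1, h3.2]
    have hd0 : 0 < ‖d‖ := by
      rw [norm_pos_iff]; intro h; apply h0
      rw [hdd, sub_eq_zero] at h; rw [h, sub_self]
    have := le_of_mul_le_mul_left h6 hd0
    nlinarith [norm_nonneg d]
  · have h1 : ‖G y - G x‖ ≤ 2 * B := (norm_sub_le _ _).trans (by linarith [hB x, hB y])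
    nlinarith

theorem hasGradientAt_of_quadratic_bound [CompleteSpace E] {v : E → ℝ} {x g : E} {C : ℝ}
    (hq : ∀ h, ‖h‖ ≤ 1 → |v (x + h) - v x - ⟪g, h⟫| ≤ C * ‖h‖ ^ 2) : HasGradientAt v g x := by
  rw [hasGradientAt_iff_hasFDerivAt, hasFDerivAt_iff_isLittleO_nhds_zero]
  have hO : (fun h : E => v (x + h) - v x - (InnerProductSpace.toDual ℝ E) g h)
      =O[𝓝 0] fun h => ‖h‖ ^ 2 := by
    refine IsBigO.of_bound C ?_
    filter_upwards [closedBall_mem_nhds (0 : E) one_pos] with h hh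
    rw [mem_closedBall_zero_iff] at hh
    simpa using hq h hh
  refine hO.trans_isLittleO ?_
  have : (fun h : E => ‖h‖ ^ 2) =o[𝓝 0] fun h : E => ‖h‖ ^ 1 :=
    isLittleO_norm_pow_norm_pow one_lt_two
  simp only [pow_one] at this
  exact this.of_norm_right

theorem norm_le_of_hasGradientAt_of_lipschitzWith [CompleteSpace E] {v : E → ℝ} {x g : E}
    {L : ℝ≥0} (hv : LipschitzWith L v) (hg : HasGradientAt v g x) : ‖g‖ ≤ L := by
  have := hg.hasFDerivAt.le_of_lipschitz hv
  simpa using this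

variable [FiniteDimensional ℝ E]

/-- The `M`-semiconvex hull of a Lipschitz semiconcave function is a `C^{1,1}` function; off the
contact set it is a paraboloid of opening `-M` in some direction. -/
theorem exists_semiconvexHull {L : ℝ≥0} {w : E → ℝ} (hw : LipschitzWith L w) {K M : ℝ}
    (hK : 0 ≤ K) (hM : 0 < M)
    (hconc : ∀ x h, ‖h‖ ≤ 1 → w (x + h) + w (x - h) - 2 * w x ≤ K * ‖h‖ ^ 2) :
    ∃ (v : E → ℝ) (G : E → E), LipschitzWith L v ∧ (∀ x, v x ≤ w x) ∧
      (∀ x, w x - 2 * L ^ 2 / M ≤ v x) ∧ (∀ x, HasGradientAt v (G x) x) ∧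
      (∃ D : ℝ≥0, LipschitzWith D G) ∧
      (∀ x h, ‖h‖ ≤ 1 → v (x + h) + v (x - h) - 2 * v x ≤ K * ‖h‖ ^ 2) ∧
      ∀ x, v x = w x ∨ ∃ d : E, d ≠ 0 ∧ ∀ t : ℝ, 0 ≤ t → t ≤ 1 →
        v (x + t • d) ≤ v x + t * ⟪G x, d⟫ - M / 2 * t ^ 2 * ‖d‖ ^ 2 := by
  have hsup : ∀ z : E, 2 * L / M < ‖z‖ → L * ‖z‖ < M / 2 * ‖z‖ ^ 2 := by
    intro z hz
    have hz0 : 0 < ‖z‖ := lt_of_le_of_lt (by positivity) hz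
    rw [div_lt_iff₀ hM] at hz
    nlinarith
  obtain ⟨m, hmL, hm1, hm2⟩ := exists_infConvolution (κ := fun z : E => M / 2 * ‖z‖ ^ 2) hw
    (by fun_prop) (by simp) (R := 2 * L / M) (by positivity) hsup
  obtain ⟨v', hvL, hv1', hv2'⟩ := exists_infConvolution (κ := fun z : E => M / 2 * ‖z‖ ^ 2)
    (g := fun x => -m x) hmL.neg (by fun_prop) (by simp) (R := 2 * L / M) (by positivity) hsup
  set v : E → ℝ := fun x => -v' x with hv
  have hv1 : ∀ x b, m b - M / 2 * ‖x - b‖ ^ 2 ≤ v x := fun x b => by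
    have := hv1' x b; simp only [hv]; linarith
  have hv2 : ∀ x, ∃ b, v x = m b - M / 2 * ‖x - b‖ ^ 2 := fun x => by
    obtain ⟨b, -, h⟩ := hv2' x
    exact ⟨b, by simp only [hv]; linarith⟩
  choose b hb using hv2
  have hvw : ∀ x, v x ≤ w x := fun x => by
    have := hm1 (b x) x
    rw [norm_sub_rev] at this
    rw [hb]; linarith
  have hsc : ∀ x h, ‖h‖ ≤ 1 → v (x + h) + v (x - h) - 2 * v x ≤ K * ‖h‖ ^ 2 := by
    intro x h hh
    set b1 := b (x + h)
    set b2 := b (x - h)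
    have hid : ∀ y : E, ‖y + h - b1‖ ^ 2 + ‖y - h - b2‖ ^ 2
        = 2 * ‖y - (1 / 2 : ℝ) • (b1 + b2)‖ ^ 2 + 2 * ‖h - (1 / 2 : ℝ) • (b1 - b2)‖ ^ 2 := by
      intro y
      have := parallelogram_law_with_norm ℝ (y - (1 / 2 : ℝ) • (b1 + b2))
        (h - (1 / 2 : ℝ) • (b1 - b2))
      rw [show y - (1 / 2 : ℝ) • (b1 + b2) + (h - (1 / 2 : ℝ) • (b1 - b2)) = y + h - b1 by module,
        show y - (1 / 2 : ℝ) • (b1 + b2) - (h - (1 / 2 : ℝ) • (b1 - b2)) = y - h - b2 by module]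
        at this
      nlinarith
    obtain ⟨y, -, hy⟩ := hm2 ((1 / 2 : ℝ) • (b1 + b2))
    have h1 := hm1 b1 (y + h)
    have h2 := hm1 b2 (y - h)
    have h3 := hconc y h hh
    have h4 := hid y
    have h5 := hid x
    have h6 := hv1 x ((1 / 2 : ℝ) • (b1 + b2))
    have h7 : v (x + h) = m b1 - M / 2 * ‖x + h - b1‖ ^ 2 := hb _
    have h8 : v (x - h) = m b2 - M / 2 * ‖x - h - b2‖ ^ 2 := hb _
    rw [norm_sub_rev] at h1 h2 hy
    have h4' := congrArg (fun t => M / 2 * t) h4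
    have h5' := congrArg (fun t => M / 2 * t) h5
    simp only [mul_add] at h4' h5'
    linarith
  set G : E → E := fun x => M • (b x - x) with hG
  have hexp : ∀ x h : E, M / 2 * ‖x + h - b x‖ ^ 2
      = M / 2 * ‖x - b x‖ ^ 2 - ⟪G x, h⟫ + M / 2 * ‖h‖ ^ 2 := by
    intro x h
    rw [show x + h - b x = (x - b x) + h by abel, norm_add_sq_real, hG]
    simp only [real_inner_smul_left]
    rw [← neg_sub x (b x), inner_neg_left]; ring
  have hlow : ∀ x h, v x + ⟪G x, h⟫ - M / 2 * ‖h‖ ^ 2 ≤ v (x + h) := by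
    intro x h
    have h1 := hv1 (x + h) (b x)
    rw [hexp] at h1
    rw [hb x]; linarith
  have hq : ∀ x h, ‖h‖ ≤ 1 → |v (x + h) - v x - ⟪G x, h⟫| ≤ (K + M) * ‖h‖ ^ 2 := by
    intro x h hh
    have h1 := hlow x h
    have h2 := hlow x (-h)
    rw [← sub_eq_add_neg, inner_neg_right, norm_neg] at h2
    have h3 := hsc x h hh
    rw [abs_le]
    have := mul_nonneg hK (sq_nonneg ‖h‖)
    have := mul_nonneg hM.le (sq_nonneg ‖h‖)
    constructor <;> linarith
  have hgrad : ∀ x, HasGradientAt v (G x) x := fun x => hasGradientAt_of_quadratic_bound (hq x)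
  have hvL' : LipschitzWith L v := hvL.neg
  refine ⟨v, G, hvL', hvw, ?_, hgrad, lipschitzWith_of_quadratic_bound (by positivity)
    (fun x => norm_le_of_hasGradientAt_of_lipschitzWith hvL' (hgrad x)) hq, hsc, ?_⟩
  · intro x
    have h1 := hv1 x x
    obtain ⟨y, hyR, hy⟩ := hm2 x
    have h2 := hw.dist_le_mul x y
    rw [dist_eq_norm, dist_eq_norm, Real.norm_eq_abs] at h2
    have h3 := le_abs_self (w x - w y)
    have h4 : L * ‖x - y‖ ≤ L * (2 * L / M) := by gcongr
    have h5 : L * (2 * L / M) = 2 * (L : ℝ) ^ 2 / M := by ring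
    have h6 : 0 ≤ M / 2 * ‖x - y‖ ^ 2 := by positivity
    simp only [sub_self, norm_zero] at h1
    norm_num at h1
    linarith
  · intro x
    obtain ⟨y, -, hy⟩ := hm2 (b x)
    rw [norm_sub_rev] at hy
    by_cases hyx : y = x
    · left
      rw [hb x, hy, hyx]; ring
    · right
      refine ⟨y - x, sub_ne_zero.mpr hyx, fun t ht0 ht1 => ?_⟩
      have hvy : v y ≤ m (b x) - M / 2 * ‖y - b x‖ ^ 2 := by
        have := hvw y
        linarith
      set z := x + t • (y - x) with hz
      have hQ : ∀ b' : E, ‖z - b'‖ ^ 2 - ‖z - b x‖ ^ 2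
          = (1 - t) * (‖x - b'‖ ^ 2 - ‖x - b x‖ ^ 2) + t * (‖y - b'‖ ^ 2 - ‖y - b x‖ ^ 2) := by
        intro b'
        simp only [norm_sub_sq_real, hz, inner_add_left, inner_smul_left, inner_sub_left]
        simp
        ring
      have h1 := hb z
      have h2 := hv1 x (b z)
      have h3 := hv1 y (b z)
      have h4 := hQ (b z)
      have h5 := hexp x (t • (y - x))
      rw [← hz, real_inner_smul_right, norm_smul, mul_pow, Real.norm_eq_abs, sq_abs] at h5
      have h6 := hb x
      have e1 := mul_le_mul_of_nonneg_left h2 (sub_nonneg.mpr ht1)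
      have e2 := mul_le_mul_of_nonneg_left (h3.trans hvy) ht0
      have h4' := congrArg (fun t => M / 2 * t) h4
      simp only [mul_sub, mul_add] at h4'
      nlinarith

end Hull

section Regularization

variable {E : Type*} [NormedAddCommGroup E] [InnerProductSpace ℝ E]

/-- At `x` the function `v` touches from below the infimal convolution of `u` with the kernel
`powKernel c j`, the infimum at `x` being attained at a point `y` with `|x - y| ≤ R`. -/
def IsContactPoint (u v : E → ℝ) (c : ℝ) (j : ℕ) (R : ℝ) (x y : E) : Prop :=
  ‖x - y‖ ≤ R ∧ v x = u y + powKernel c j (x - y) ∧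
    ∀ a b, v a ≤ u b + powKernel c j (a - b)

/-- A `C^{1,1}` approximation from below of a Lipschitz function `u`. -/
theorem exists_regularization [FiniteDimensional ℝ E] {L : ℝ≥0} {u : E → ℝ}
    (hu : LipschitzWith L u) {c R M : ℝ} (j : ℕ) (hc : 0 < c) (hR : 0 < R)
    (hcR : L ≤ c * R ^ (2 * j + 3)) (hM : 0 < M) :
    ∃ (v : E → ℝ) (G : E → E), LipschitzWith L v ∧ (∀ x, v x ≤ u x) ∧
      (∀ x, u x - L * R - 2 * L ^ 2 / M ≤ v x) ∧ (∀ x, HasGradientAt v (G x) x) ∧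
      (∃ D : ℝ≥0, LipschitzWith D G) ∧
      (∀ x h, ‖h‖ ≤ 1 → v (x + h) + v (x - h) - 2 * v x
        ≤ 10 * (j + 2) ^ 2 * c * ((R + 1) ^ 2) ^ (j + 1) * ‖h‖ ^ 2) ∧
      ∀ x, (∃ y, IsContactPoint u v c j R x y) ∨ ∃ d : E, d ≠ 0 ∧ ∀ t : ℝ, 0 ≤ t → t ≤ 1 →
        v (x + t • d) ≤ v x + t * ⟪G x, d⟫ - M / 2 * t ^ 2 * ‖d‖ ^ 2 := by
  have hsup : ∀ z : E, R < ‖z‖ → L * ‖z‖ < powKernel c j z := by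
    intro z hz
    have hz0 : 0 < ‖z‖ := hR.trans hz
    have h1 : (L : ℝ) < c * ‖z‖ ^ (2 * j + 3) := hcR.trans_lt (by gcongr)
    calc L * ‖z‖ < c * ‖z‖ ^ (2 * j + 3) * ‖z‖ := by gcongr
      _ = powKernel c j z := by rw [powKernel, ← pow_mul]; ring
  obtain ⟨w, hwL, hw1, hw2⟩ := exists_infConvolution hu (continuous_powKernel c j)
    (powKernel_zero c j) hR.le hsup
  have hconc : ∀ x h, ‖h‖ ≤ 1 → w (x + h) + w (x - h) - 2 * w x
        ≤ 10 * (j + 2) ^ 2 * c * ((R + 1) ^ 2) ^ (j + 1) * ‖h‖ ^ 2 := by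
    intro x h hh
    obtain ⟨y, hyR, hy⟩ := hw2 x
    have h1 := hw1 (x + h) y
    have h2 := hw1 (x - h) y
    have h3 := powKernel_add_le hc.le j (x - y) h
    have h4 := powKernel_add_le hc.le j (x - y) (-h)
    rw [show x + h - y = x - y + h by abel] at h1
    rw [show x - h - y = x - y + -h by abel] at h2
    rw [inner_neg_right, norm_neg] at h4
    have h5 : 5 * ((j : ℝ) + 2) ^ 2 * c * ((‖x - y‖ + ‖h‖) ^ 2) ^ (j + 1) * ‖h‖ ^ 2
        ≤ 5 * (j + 2) ^ 2 * c * ((R + 1) ^ 2) ^ (j + 1) * ‖h‖ ^ 2 := by gcongr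
    linarith
  obtain ⟨v, G, hvL, hvw, hwv, hgrad, hGL, hsc, halt⟩ :=
    exists_semiconvexHull hwL (by positivity) hM hconc
  refine ⟨v, G, hvL, fun x => ?_, fun x => ?_, hgrad, hGL, hsc, fun x => ?_⟩
  · have := hw1 x x
    rw [sub_self, powKernel_zero, add_zero] at this
    exact (hvw x).trans this
  · obtain ⟨y, hyR, hy⟩ := hw2 x
    have h2 := hu.dist_le_mul x y
    rw [dist_eq_norm, dist_eq_norm, Real.norm_eq_abs] at h2
    have h3 := le_abs_self (u x - u y)
    have h4 : L * ‖x - y‖ ≤ L * R := by gcongr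
    have h6 : 0 ≤ powKernel c j (x - y) := by unfold powKernel; positivity
    linarith [hwv x]
  · rcases halt x with h | h
    · left
      obtain ⟨y, hyR, hy⟩ := hw2 x
      exact ⟨y, hyR, h.trans hy, fun x' y' => (hvw x').trans (hw1 x' y')⟩
    · exact Or.inr h

end Regularization

section SecondOrder

variable {E : Type*} [NormedAddCommGroup E] [InnerProductSpace ℝ E] [CompleteSpace E]

/-- Second order Taylor expansion at a point of differentiability of the gradient. -/
theorem eventually_taylor_two {v : E → ℝ} {G : E → E} (hG : ∀ x, HasGradientAt v (G x) x)
    {x : E} {X : E →L[ℝ] E} (hX : HasFDerivAt G X x) {η : ℝ} (hη : 0 < η) :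
    ∀ᶠ h in 𝓝 (0 : E), |v (x + h) - v x - ⟪G x, h⟫ - 1 / 2 * ⟪X h, h⟫| ≤ η * ‖h‖ ^ 2 := by
  rw [hasFDerivAt_iff_isLittleO_nhds_zero] at hX
  have h1 := hX.bound hη
  rw [Metric.eventually_nhds_iff_ball] at h1 ⊢
  obtain ⟨δ, hδ, hb⟩ := h1
  refine ⟨δ, hδ, fun h hh => ?_⟩
  have hder : ∀ t ∈ Icc (0 : ℝ) 1, HasDerivWithinAt
      (fun t : ℝ => v (x + t • h) - t * ⟪G x, h⟫ - t ^ 2 / 2 * ⟪X h, h⟫)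
      (⟪G (x + t • h) - G x - X (t • h), h⟫) (Icc 0 1) t := by
    intro t _
    have e1 : HasDerivAt (fun t : ℝ => x + t • h) h t := by
      simpa using ((hasDerivAt_id t).smul_const h).const_add x
    have e2 : HasDerivAt (fun t : ℝ => v (x + t • h)) ⟪G (x + t • h), h⟫ t := by
      exact ((hG (x + t • h)).hasFDerivAt.comp_hasDerivAt t e1).congr_deriv (by simp)
    have e3 : HasDerivAt (fun t : ℝ => t * ⟪G x, h⟫) ⟪G x, h⟫ t := by
      simpa using (hasDerivAt_id t).mul_const ⟪G x, h⟫
    have e4 : HasDerivAt (fun t : ℝ => t ^ 2 / 2 * ⟪X h, h⟫) (t * ⟪X h, h⟫) t := by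
      exact ((((hasDerivAt_id t).pow 2).div_const 2).mul_const ⟪X h, h⟫).congr_deriv (by simp)
    refine (((e2.sub e3).sub e4).congr_deriv ?_).hasDerivWithinAt
    rw [inner_sub_left, inner_sub_left, map_smul, real_inner_smul_left]
  have hbound : ∀ t ∈ Ico (0 : ℝ) 1, ‖⟪G (x + t • h) - G x - X (t • h), h⟫‖ ≤ η * ‖h‖ ^ 2 := by
    intro t ht
    have hle : ‖t • h‖ ≤ ‖h‖ := by
      rw [norm_smul, Real.norm_eq_abs, abs_of_nonneg ht.1]
      exact mul_le_of_le_one_left (norm_nonneg _) ht.2.le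
    have h2 := hb (t • h) (by
      rw [mem_ball_zero_iff] at hh ⊢
      exact hle.trans_lt hh)
    calc _ ≤ ‖G (x + t • h) - G x - X (t • h)‖ * ‖h‖ := norm_inner_le_norm _ _
      _ ≤ η * ‖h‖ * ‖h‖ := by
        gcongr
        exact h2.trans (by gcongr)
      _ = _ := by ring
  have := norm_image_sub_le_of_norm_deriv_le_segment_01' hder hbound
  rw [Real.norm_eq_abs] at this
  convert this using 2
  simp
  ring

theorem tendsto_taylor_two {v : E → ℝ} {G : E → E} (hG : ∀ x, HasGradientAt v (G x) x)
    {x : E} {X : E →L[ℝ] E} (hX : HasFDerivAt G X x) (d : E) :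
    Tendsto (fun t : ℝ => (v (x + t • d) - v x - t * ⟪G x, d⟫) / t ^ 2) (𝓝[>] 0)
      (𝓝 (1 / 2 * ⟪X d, d⟫)) := by
  rw [Metric.tendsto_nhds]
  intro ε hε
  have hη : 0 < ε / (2 * (‖d‖ ^ 2 + 1)) := by positivity
  have hto : Tendsto (fun t : ℝ => t • d) (𝓝[>] 0) (𝓝 (0 : E)) := by
    have : Tendsto (fun t : ℝ => t • d) (𝓝 0) (𝓝 ((0 : ℝ) • d)) :=
      (continuous_id.smul continuous_const).tendsto 0
    rw [zero_smul] at this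
    exact this.mono_left nhdsWithin_le_nhds
  filter_upwards [hto.eventually (eventually_taylor_two hG hX hη), self_mem_nhdsWithin]
    with t ht ht0
  have ht0' : (0 : ℝ) < t := ht0
  rw [real_inner_smul_right, map_smul, real_inner_smul_left, real_inner_smul_right, norm_smul,
    Real.norm_eq_abs, abs_of_pos ht0'] at ht
  rw [Real.dist_eq]
  have e : (v (x + t • d) - v x - t * ⟪G x, d⟫) / t ^ 2 - 1 / 2 * ⟪X d, d⟫
      = (v (x + t • d) - v x - t * ⟪G x, d⟫ - 1 / 2 * (t * (t * ⟪X d, d⟫))) / t ^ 2 := by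
    field_simp
  rw [e, abs_div, abs_of_pos (by positivity : (0 : ℝ) < t ^ 2), div_lt_iff₀ (by positivity)]
  refine ht.trans_lt ?_
  have : ε / (2 * (‖d‖ ^ 2 + 1)) * ‖d‖ ^ 2 < ε := by
    rw [div_mul_eq_mul_div, div_lt_iff₀ (by positivity)]
    nlinarith [sq_nonneg ‖d‖]
  calc _ = (ε / (2 * (‖d‖ ^ 2 + 1)) * ‖d‖ ^ 2) * t ^ 2 := by ring
    _ < _ := by gcongr

/-- A one-sided quadratic bound along a ray bounds the second derivative. -/
theorem inner_hessian_le {v : E → ℝ} {G : E → E} (hG : ∀ x, HasGradientAt v (G x) x)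
    {x : E} {X : E →L[ℝ] E} (hX : HasFDerivAt G X x) {d : E} {q : ℝ → ℝ} {a : ℝ}
    (hq : Tendsto q (𝓝[>] 0) (𝓝 (a / 2)))
    (h : ∀ᶠ t in 𝓝[>] (0 : ℝ), v (x + t • d) ≤ v x + t * ⟪G x, d⟫ + q t * t ^ 2) :
    ⟪X d, d⟫ ≤ a := by
  have := le_of_tendsto_of_tendsto (tendsto_taylor_two hG hX d) hq (by
    filter_upwards [h, self_mem_nhdsWithin] with t ht ht0
    have ht0' : (0 : ℝ) < t := ht0
    rw [div_le_iff₀ (by positivity)]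
    linarith)
  linarith

theorem inner_hessian_le_of_semiconcave {v : E → ℝ} {G : E → E}
    (hG : ∀ x, HasGradientAt v (G x) x) {x : E} {X : E →L[ℝ] E} (hX : HasFDerivAt G X x) {K : ℝ}
    (hsc : ∀ h, ‖h‖ ≤ 1 → v (x + h) + v (x - h) - 2 * v x ≤ K * ‖h‖ ^ 2) (d : E) :
    ⟪X d, d⟫ ≤ K * ‖d‖ ^ 2 := by
  have h1 := (tendsto_taylor_two hG hX d).add (tendsto_taylor_two hG hX (-d))
  have hto : Tendsto (fun t : ℝ => t • d) (𝓝[>] 0) (𝓝 (0 : E)) := by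
    have : Tendsto (fun t : ℝ => t • d) (𝓝 0) (𝓝 ((0 : ℝ) • d)) :=
      (continuous_id.smul continuous_const).tendsto 0
    rw [zero_smul] at this
    exact this.mono_left nhdsWithin_le_nhds
  have := le_of_tendsto h1 (b := K * ‖d‖ ^ 2) (by
    filter_upwards [hto.eventually (closedBall_mem_nhds (0 : E) one_pos), self_mem_nhdsWithin]
      with t ht ht0
    have ht0' : (0 : ℝ) < t := ht0
    have h2 := hsc (t • d) (by simpa using ht)
    rw [← add_div, div_le_iff₀ (by positivity), inner_neg_right, smul_neg, ← sub_eq_add_neg x]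
    rw [norm_smul, Real.norm_eq_abs, abs_of_pos ht0'] at h2
    linarith)
  rw [map_neg, inner_neg_left, inner_neg_right] at this
  linarith

end SecondOrder

section Contact

variable {E : Type*} [NormedAddCommGroup E] [InnerProductSpace ℝ E] [CompleteSpace E]

theorem IsContactPoint.gradient_eq {u v : E → ℝ} {c R : ℝ} {j : ℕ} {x y g : E} (hc : 0 ≤ c)
    (h : IsContactPoint u v c j R x y) (hg : HasGradientAt v g x) :
    g = powKernelGrad c j (x - y) := by
  obtain ⟨-, h0, h1⟩ := h
  set k := powKernelGrad c j (x - y)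
  set C := 5 * ((j : ℝ) + 2) ^ 2 * c * ((‖x - y‖ + 1) ^ 2) ^ (j + 1) with hC
  have hmax : IsLocalMax (fun x' => v x' - (⟪k, x' - x⟫ + C * ‖x' - x‖ ^ 2)) x := by
    filter_upwards [closedBall_mem_nhds x one_pos] with x' hx'
    rw [mem_closedBall, dist_eq_norm] at hx'
    have h2 := h1 x' y
    have h3 := powKernel_add_le hc j (x - y) (x' - x)
    rw [show x - y + (x' - x) = x' - y by abel] at h3
    have h4 : 5 * ((j : ℝ) + 2) ^ 2 * c * ((‖x - y‖ + ‖x' - x‖) ^ 2) ^ (j + 1) * ‖x' - x‖ ^ 2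
        ≤ C * ‖x' - x‖ ^ 2 := by rw [hC]; gcongr
    simp only [sub_self, inner_zero_right, norm_zero]
    norm_num
    linarith
  have hsub : HasFDerivAt (fun x' : E => x' - x) (ContinuousLinearMap.id ℝ E) x :=
    (hasFDerivAt_id x).sub_const x
  have hder := hmax.hasFDerivAt_eq_zero
    (hg.hasFDerivAt.sub (((hasFDerivAt_const k x).inner ℝ hsub).add
      ((hsub.norm_sq).const_mul C)))
  have := congrArg (fun f => f (g - k)) hder
  simp at this
  rw [← inner_sub_left, inner_self_eq_zero, sub_eq_zero] at this
  exact this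

theorem IsContactPoint.inner_hessian_le {u v : E → ℝ} {c R : ℝ} {j : ℕ} {x y : E} (hc : 0 ≤ c)
    (h : IsContactPoint u v c j R x y) {G : E → E} (hG : ∀ x, HasGradientAt v (G x) x)
    {X : E →L[ℝ] E} (hX : HasFDerivAt G X x) (d : E) :
    ⟪X d, d⟫ ≤ 10 * (j + 2) ^ 2 * c * (‖x - y‖ ^ 2) ^ (j + 1) * ‖d‖ ^ 2 := by
  have hgr := h.gradient_eq hc (hG x)
  obtain ⟨-, h0, h1⟩ := h
  refine _root_.inner_hessian_le hG hX
    (q := fun t => 5 * ((j : ℝ) + 2) ^ 2 * c * ((‖x - y‖ + t * ‖d‖) ^ 2) ^ (j + 1) * ‖d‖ ^ 2) ?_ ?_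
  · have : Continuous (fun t : ℝ =>
      5 * ((j : ℝ) + 2) ^ 2 * c * ((‖x - y‖ + t * ‖d‖) ^ 2) ^ (j + 1) * ‖d‖ ^ 2) := by fun_prop
    have h2 := (this.tendsto 0).mono_left (nhdsWithin_le_nhds (s := Ioi 0))
    convert h2 using 2
    simp
    ring
  · filter_upwards [self_mem_nhdsWithin] with t ht
    have ht0 : (0 : ℝ) < t := ht
    have h2 := h1 (x + t • d) y
    have h3 := powKernel_add_le hc j (x - y) (t • d)
    rw [show x - y + t • d = x + t • d - y by abel, norm_smul, Real.norm_eq_abs, abs_of_pos ht0,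
      real_inner_smul_right, ← hgr] at h3
    linarith

end Contact

section Viscosity

variable {n : ℕ}

theorem gradient_quadratic (y ξ : En n) (a : ℝ) (T : En n →L[ℝ] En n) :
    gradient (fun z => a + ⟪ξ, z - y⟫ + 1 / 2 * ⟪T (z - y), z - y⟫)
      = fun z => ξ + ((1 / 2 : ℝ) • (T + ContinuousLinearMap.adjoint T)) (z - y) := by
  funext z
  apply HasGradientAt.gradient
  rw [hasGradientAt_iff_hasFDerivAt]
  have hsub : HasFDerivAt (fun x' : En n => x' - y) (ContinuousLinearMap.id ℝ (En n)) z :=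
    (hasFDerivAt_id z).sub_const y
  have hT : HasFDerivAt (fun x' : En n => T (x' - y)) T z := by
    exact (T.hasFDerivAt.comp z hsub).congr_fderiv (by ext; simp)
  have h1 := (((hasFDerivAt_const ξ z).inner ℝ hsub).const_add a).add
    ((hT.inner ℝ hsub).const_mul (1 / 2))
  refine h1.congr_fderiv ?_
  ext w
  simp [inner_sub_left, ContinuousLinearMap.adjoint_inner_left]
  rw [inner_sub_right, real_inner_comm z (T w), real_inner_comm y (T w)]
  ring

theorem trace_adjoint_eq (T : En n →L[ℝ] En n) :
    LinearMap.trace ℝ (En n) (ContinuousLinearMap.adjoint T : En n →L[ℝ] En n)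
      = LinearMap.trace ℝ (En n) T := by
  rw [LinearMap.trace_eq_sum_inner _ (EuclideanSpace.basisFun (Fin n) ℝ),
    LinearMap.trace_eq_sum_inner _ (EuclideanSpace.basisFun (Fin n) ℝ)]
  refine Finset.sum_congr rfl fun i _ => ?_
  simp only [ContinuousLinearMap.coe_coe]
  rw [ContinuousLinearMap.adjoint_inner_right, real_inner_comm]

/-- Testing a viscosity supersolution with a quadratic polynomial. -/
theorem IsViscositySupersolution.quadratic {p u : En n → ℝ} {U : Set (En n)}
    (hu : IsViscositySupersolution p u U) {y : En n} (hy : y ∈ U) {ξ : En n} (hξ : ξ ≠ 0)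
    (T : En n →L[ℝ] En n)
    (hT : ∀ᶠ h in 𝓝 (0 : En n), h ≠ 0 → u y + ⟪ξ, h⟫ + 1 / 2 * ⟪T h, h⟫ < u (y + h)) :
    LinearMap.trace ℝ (En n) T + (p y - 2) * (⟪T ξ, ξ⟫ / ‖ξ‖ ^ 2)
      + Real.log ‖ξ‖ * ⟪gradient p y, ξ⟫ ≤ 0 := by
  set φ : En n → ℝ := fun z => u y + ⟪ξ, z - y⟫ + 1 / 2 * ⟪T (z - y), z - y⟫ with hφ
  have hgr := gradient_quadratic y ξ (u y) T
  rw [← hφ] at hgr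
  have hgy : gradient φ y = ξ := by rw [hgr]; simp
  have hH : fderiv ℝ (gradient φ) y = (1 / 2 : ℝ) • (T + ContinuousLinearMap.adjoint T) := by
    rw [hgr]
    have hsub : HasFDerivAt (fun x' : En n => x' - y) (ContinuousLinearMap.id ℝ (En n)) y :=
      (hasFDerivAt_id y).sub_const y
    exact (((ContinuousLinearMap.hasFDerivAt _).comp y hsub).const_add ξ).fderiv
  have hev : ∀ᶠ x in 𝓝[≠] y, φ x < u x := by
    rw [eventually_nhdsWithin_iff]
    have hto : Tendsto (fun x : En n => x - y) (𝓝 y) (𝓝 0) := by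
      have h1 : Continuous (fun x : En n => x - y) := by fun_prop
      simpa using h1.tendsto y
    filter_upwards [hto.eventually hT] with x hx hxy
    have := hx (sub_ne_zero.mpr hxy)
    rwa [add_sub_cancel] at this
  have h := hu y hy φ (by
    rw [hφ]
    have : ContDiff ℝ 2 (fun z : En n => u y + ⟪ξ, z - y⟫ + 1 / 2 * ⟪T (z - y), z - y⟫) := by
      have h1 : ContDiff ℝ 2 (fun z : En n => z - y) := contDiff_id.sub contDiff_const
      exact (contDiff_const.add (contDiff_const.inner ℝ h1)).add
        (contDiff_const.mul ((T.contDiff.comp h1).inner ℝ h1))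
    exact this.contDiffAt) (by simp [hφ]) hev (by rwa [hgy])
  rw [negPLap, hgy, hH] at h
  have htr : LinearMap.trace ℝ (En n)
      (((1 / 2 : ℝ) • (T + ContinuousLinearMap.adjoint T) : En n →L[ℝ] En n) :
        En n →ₗ[ℝ] En n) = LinearMap.trace ℝ (En n) T := by
    have := trace_adjoint_eq T
    simp only [ContinuousLinearMap.toLinearMap_smul, ContinuousLinearMap.toLinearMap_add,
      map_smul, map_add]
    rw [this, smul_eq_mul]; ring
  have hin : ⟪((1 / 2 : ℝ) • (T + ContinuousLinearMap.adjoint T)) ξ, ξ⟫ = ⟪T ξ, ξ⟫ := by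
    simp [inner_add_left, ContinuousLinearMap.adjoint_inner_left, real_inner_smul_left]
    rw [real_inner_comm (T ξ) ξ]; ring
  rw [htr, hin] at h
  have hn : 0 < ‖ξ‖ := norm_pos_iff.mpr hξ
  have hpow : ‖ξ‖ ^ (p y - 4) = ‖ξ‖ ^ (p y - 2) / ‖ξ‖ ^ 2 := by
    rw [show p y - 4 = (p y - 2) - (2 : ℕ) by push_cast; ring, Real.rpow_sub_natCast hn.ne']
  rw [hpow] at h
  have hpos : 0 < ‖ξ‖ ^ (p y - 2) := Real.rpow_pos_of_pos hn _
  have : ‖ξ‖ ^ (p y - 2) * (LinearMap.trace ℝ (En n) T + (p y - 2) * (⟪T ξ, ξ⟫ / ‖ξ‖ ^ 2)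
      + Real.log ‖ξ‖ * ⟪gradient p y, ξ⟫) ≤ ‖ξ‖ ^ (p y - 2) * 0 := by
    rw [mul_zero]
    have e : (p y - 2) * (‖ξ‖ ^ (p y - 2) / ‖ξ‖ ^ 2) * ⟪T ξ, ξ⟫
      = ‖ξ‖ ^ (p y - 2) * ((p y - 2) * (⟪T ξ, ξ⟫ / ‖ξ‖ ^ 2)) := by ring
    rw [e] at h
    linarith
  exact le_of_mul_le_mul_left this hpos

end Viscosity

section ViscosityContact

variable {n : ℕ}

/-- The trace of a rank-one modification of a conjugate of `X`, from its quadratic form. -/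
theorem trace_eq_of_inner_self {T X : En n →L[ℝ] En n} {e : En n} (he : ‖e‖ = 1) {θ a b : ℝ}
    (hT : ∀ h, ⟪T h, h⟫ = ⟪X (h + (θ * ⟪e, h⟫) • e), h + (θ * ⟪e, h⟫) • e⟫
      - a * ‖h‖ ^ 2 - b * ⟪e, h⟫ ^ 2) :
    LinearMap.trace ℝ (En n) T = LinearMap.trace ℝ (En n) X
        + (2 * θ + θ ^ 2) * ⟪X e, e⟫ - a * n - b := by
  set β := EuclideanSpace.basisFun (Fin n) ℝ with hβ
  have h1 : ∑ i, ⟪e, β i⟫ * ⟪β i, X e⟫ = ⟪X e, e⟫ := by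
    rw [OrthonormalBasis.sum_inner_mul_inner, real_inner_comm]
  have h2 : ∑ i, ⟪e, β i⟫ * ⟪β i, ContinuousLinearMap.adjoint X e⟫ = ⟪X e, e⟫ := by
    rw [OrthonormalBasis.sum_inner_mul_inner, ContinuousLinearMap.adjoint_inner_right]
  have h3 : ∑ i, ⟪e, β i⟫ * ⟪β i, e⟫ = 1 := by
    rw [OrthonormalBasis.sum_inner_mul_inner, real_inner_self_eq_norm_sq, he, one_pow]
  have h4 : ∑ _i : Fin n, (1 : ℝ) = n := by simp
  rw [LinearMap.trace_eq_sum_inner _ β, LinearMap.trace_eq_sum_inner _ β]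
  have h5 : ∀ i, ⟪β i, T (β i)⟫ = ⟪β i, X (β i)⟫ + θ * (⟪e, β i⟫ * ⟪β i, X e⟫)
      + θ * (⟪e, β i⟫ * ⟪β i, ContinuousLinearMap.adjoint X e⟫)
      + (θ ^ 2 * ⟪X e, e⟫ - b) * (⟪e, β i⟫ * ⟪β i, e⟫) - a * 1 := by
    intro i
    rw [real_inner_comm, hT, β.norm_eq_one, ContinuousLinearMap.adjoint_inner_right, map_add,
      map_smul, inner_add_left, inner_add_right, inner_add_right, real_inner_smul_left,
      real_inner_smul_left, real_inner_smul_right, real_inner_smul_right,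
      real_inner_comm (X (β i)) (β i), real_inner_comm (X e) (β i), real_inner_comm e (β i)]
    ring
  simp only [ContinuousLinearMap.coe_coe, h5, Finset.sum_add_distrib, Finset.sum_sub_distrib,
    ← Finset.mul_sum, h1, h2, h3, h4]
  ring

open InnerProductSpace in
/-- The pointwise inequality for the regularized function at a contact point. The test function
for `u` at `y` is obtained from `v` at `x` by a linear change of variables which compensates the
difference between the exponents `p x` and `p y`. -/
theorem IsContactPoint.viscosity_ineq {p u v : En n → ℝ} {U : Set (En n)}
    (hu : IsViscositySupersolution p u U) {c R : ℝ} {j : ℕ} {x y : En n} (hc : 0 ≤ c)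
    (h : IsContactPoint u v c j R x y) (hy : y ∈ U) {G : En n → En n}
    (hG : ∀ x, HasGradientAt v (G x) x) {X : En n →L[ℝ] En n} (hX : HasFDerivAt G X x)
    (hξ : G x ≠ 0) {θ : ℝ} (hθ : (1 + θ) ^ 2 * (p y - 1) = p x - 1) :
    LinearMap.trace ℝ (En n) X + (p x - 2) * (⟪X (G x), G x⟫ / ‖G x‖ ^ 2)
      + Real.log ‖G x‖ * ⟪gradient p y, G x⟫
      ≤ (p y - 1) * (10 * (j + 2) ^ 2 * c * (‖x - y‖ ^ 2) ^ (j + 1)) * θ ^ 2 := by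
  have hgr := h.gradient_eq hc (hG x)
  obtain ⟨-, h0, h1⟩ := h
  set ξ := G x with hξdef
  set H := 10 * ((j : ℝ) + 2) ^ 2 * c * (‖x - y‖ ^ 2) ^ (j + 1) with hH
  have hn : 0 < ‖ξ‖ := norm_pos_iff.mpr hξ
  set e : En n := ‖ξ‖⁻¹ • ξ with he
  have hen : ‖e‖ = 1 := by rw [he, norm_smul, norm_inv, norm_norm, inv_mul_cancel₀ hn.ne']
  have hee : ⟪e, e⟫ = 1 := by rw [real_inner_self_eq_norm_sq, hen]; norm_num
  have hξe : ξ = ‖ξ‖ • e := by rw [he, smul_smul, mul_inv_cancel₀ hn.ne', one_smul]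
  have hquot : ∀ T : En n →L[ℝ] En n, ⟪T ξ, ξ⟫ / ‖ξ‖ ^ 2 = ⟪T e, e⟫ := by
    intro T
    rw [he, map_smul, real_inner_smul_left, real_inner_smul_right]; field_simp
  set P : En n →L[ℝ] En n := rankOne ℝ e e with hP
  have hPa : ∀ h, P h = ⟪e, h⟫ • e := fun h => by rw [hP, rankOne_apply]
  set B : En n →L[ℝ] En n := 1 + θ • P with hB
  have hBa : ∀ h, B h = h + (θ * ⟪e, h⟫) • e := fun h => by
    rw [hB]; simp [hPa, smul_smul]
  have hBsymm : ∀ a b, ⟪B a, b⟫ = ⟪a, B b⟫ := by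
    intro a b
    rw [hBa, hBa, inner_add_left, inner_add_right, real_inner_smul_left, real_inner_smul_right,
      real_inner_comm a e]
    ring
  have hBe : B e = (1 + θ) • e := by rw [hBa, hee, add_smul, one_smul, mul_one]
  have key : ∀ η : ℝ, 0 < η →
      LinearMap.trace ℝ (En n) X + (p x - 2) * ⟪X e, e⟫
      + Real.log ‖ξ‖ * ⟪gradient p y, ξ⟫ - (p y - 1) * H * θ ^ 2
      ≤ 2 * η * (n + p y - 2) := by
    intro η hη
    set T : En n →L[ℝ] En n := B * X * B - (2 * η) • 1 - (H * θ ^ 2) • P with hT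
    have hTa : ∀ h, ⟪T h, h⟫ = ⟪X (B h), B h⟫ - 2 * η * ‖h‖ ^ 2 - H * θ ^ 2 * ⟪e, h⟫ ^ 2 := by
      intro h
      rw [hT]
      simp only [sub_apply, mul_apply_eq_comp, smul_apply, one_apply_eq_self, inner_sub_left,
        real_inner_smul_left, hBsymm, hPa, real_inner_self_eq_norm_sq]
      ring
    have hBn : ∀ h, ‖B h‖ ≤ (1 + |θ|) * ‖h‖ := by
      intro h
      rw [hBa]
      refine (norm_add_le _ _).trans ?_
      rw [norm_smul, hen, norm_mul, Real.norm_eq_abs, mul_one, add_mul, one_mul]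
      gcongr
      simpa [hen] using norm_inner_le_norm (𝕜 := ℝ) e h
    set η' := η / (2 * ((1 + |θ|) ^ 2 + θ ^ 2)) with hη'
    have hη'0 : 0 < η' := by positivity
    have hBto : Tendsto (fun h => B h) (𝓝 (0 : En n)) (𝓝 0) := by
      simpa using B.continuous.tendsto 0
    have hqto : ∀ᶠ h in 𝓝 (0 : En n),
        5 * ((j : ℝ) + 2) ^ 2 * c * ((‖x - y‖ + ‖(θ * ⟪e, h⟫) • e‖) ^ 2) ^ (j + 1)
          < H / 2 + η' := by
      have hcont : Continuous (fun h : En n =>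
        5 * ((j : ℝ) + 2) ^ 2 * c * ((‖x - y‖ + ‖(θ * ⟪e, h⟫) • e‖) ^ 2) ^ (j + 1)) := by
        fun_prop
      have := hcont.tendsto 0
      refine this.eventually (gt_mem_nhds ?_)
      simp
      rw [hH]
      linarith
    have hvis := hu.quadratic hy hξ T (by
      filter_upwards [hBto.eventually (eventually_taylor_two hG hX hη'0), hqto] with h ht hq hne
      have hnorm : 0 < ‖h‖ := norm_pos_iff.mpr hne
      have e1 := h1 (x + B h) (y + h)
      set s : En n := (θ * ⟪e, h⟫) • e with hs
      have hsn : ‖s‖ ^ 2 = θ ^ 2 * ⟪e, h⟫ ^ 2 := by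
        rw [hs, norm_smul, hen, mul_one, Real.norm_eq_abs, sq_abs]; ring
      have e2 := powKernel_add_le hc j (x - y) s
      rw [show x + B h - (y + h) = x - y + s by rw [hBa]; abel] at e1
      rw [← hgr] at e2
      have e3 := (abs_le.mp ht).1
      have e4 := mul_le_mul_of_nonneg_right hq.le (sq_nonneg ‖s‖)
      have e5 : ⟪ξ, B h⟫ = ⟪ξ, h⟫ + ⟪ξ, s⟫ := by rw [hBa, inner_add_right]
      have e6 : η' * (‖B h‖ ^ 2 + ‖s‖ ^ 2) < η * ‖h‖ ^ 2 := by
        have f1 : ‖B h‖ ^ 2 ≤ (1 + |θ|) ^ 2 * ‖h‖ ^ 2 := by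
          rw [← mul_pow]; gcongr; exact hBn h
        have f2 : ‖s‖ ^ 2 ≤ θ ^ 2 * ‖h‖ ^ 2 := by
          rw [hsn, ← sq_abs ⟪e, h⟫]; gcongr
          simpa [hen] using norm_inner_le_norm (𝕜 := ℝ) e h
        calc η' * (‖B h‖ ^ 2 + ‖s‖ ^ 2)
            ≤ η' * (((1 + |θ|) ^ 2 + θ ^ 2) * ‖h‖ ^ 2) := by gcongr; linarith
          _ = η / 2 * ‖h‖ ^ 2 := by rw [hη']; field_simp
          _ < η * ‖h‖ ^ 2 := by gcongr; linarith
      rw [hTa]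
      rw [← hξdef] at e3
      rw [hsn] at *
      nlinarith)
    rw [hquot, hTa, hBe, hee, hen, map_smul, real_inner_smul_left, real_inner_smul_right] at hvis
    have htr : LinearMap.trace ℝ (En n) T = LinearMap.trace ℝ (En n) X
        + (2 * θ + θ ^ 2) * ⟪X e, e⟫ - 2 * η * n - H * θ ^ 2 := by
      refine trace_eq_of_inner_self hen fun h => ?_
      rw [hTa, hBa]
    rw [htr] at hvis
    linear_combination hvis - hθ * ⟪X e, e⟫
  rw [hquot X]
  have hlim : Tendsto (fun η : ℝ => 2 * η * (n + p y - 2)) (𝓝[>] 0) (𝓝 0) := by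
    have : Continuous (fun η : ℝ => 2 * η * (n + p y - 2)) := by fun_prop
    simpa using (this.tendsto 0).mono_left (nhdsWithin_le_nhds (s := Ioi 0))
  have := ge_of_tendsto hlim (by filter_upwards [self_mem_nhdsWithin] with η hη using key η hη)
  linarith

end ViscosityContact

section AnisotropicTrace

variable {n : ℕ}

theorem inner_le_trace_of_nonneg {Z : En n →L[ℝ] En n} (hZ : ∀ h, 0 ≤ ⟪Z h, h⟫) {a : En n}
    (ha : ‖a‖ ≤ 1) : ⟪Z a, a⟫ ≤ LinearMap.trace ℝ (En n) Z := by
  have htr : ∀ (s : Finset (En n)) (b : OrthonormalBasis s ℝ (En n)),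
      LinearMap.trace ℝ (En n) Z = ∑ i, ⟪Z (b i), b i⟫ := by
    intro s b
    rw [LinearMap.trace_eq_sum_inner _ b]
    exact Finset.sum_congr rfl fun i _ => real_inner_comm _ _
  rcases eq_or_ne a 0 with rfl | ha0
  · obtain ⟨s, b, -⟩ := exists_orthonormalBasis ℝ (En n)
    rw [htr s b]
    simpa using Finset.sum_nonneg fun i _ => hZ (b i)
  · have hn : 0 < ‖a‖ := norm_pos_iff.mpr ha0
    set e : En n := ‖a‖⁻¹ • a with he
    have hen : ‖e‖ = 1 := by rw [he, norm_smul, norm_inv, norm_norm, inv_mul_cancel₀ hn.ne']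
    have hae : a = ‖a‖ • e := by rw [he, smul_smul, mul_inv_cancel₀ hn.ne', one_smul]
    have hort : Orthonormal ℝ (Subtype.val : ({e} : Set (En n)) → En n) := by
      refine ⟨fun i => ?_, fun i k hik => ?_⟩
      · rw [show (i : En n) = e from i.2]; exact hen
      · exact absurd (Subtype.ext ((show (i : En n) = e from i.2).trans
          (show (k : En n) = e from k.2).symm)) hik
    obtain ⟨s, b, hs, hb⟩ := hort.exists_orthonormalBasis_extension
    have hes : e ∈ s := hs (mem_singleton e)
    have h1 : ⟪Z e, e⟫ ≤ LinearMap.trace ℝ (En n) Z := by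
      rw [htr s b]
      have := Finset.single_le_sum (f := fun i => ⟪Z (b i), b i⟫) (fun i _ => hZ (b i))
        (Finset.mem_univ (⟨e, hes⟩ : s))
      simpa [hb] using this
    have h2 : ⟪Z a, a⟫ = ‖a‖ ^ 2 * ⟪Z e, e⟫ := by
      rw [hae, map_smul, real_inner_smul_left, real_inner_smul_right, ← hae]; ring
    rw [h2]
    exact (mul_le_of_le_one_left (hZ e) (pow_le_one₀ (norm_nonneg a) ha)).trans h1

/-- If `X ≤ K` and `X` has a direction of strong concavity, then so has its anisotropic trace. -/
theorem anisotropic_trace_le_of_concave_direction {X : En n →L[ℝ] En n} {K M q q₂ a₀ : ℝ}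
    (hK : 0 ≤ K) (hX : ∀ h, ⟪X h, h⟫ ≤ K * ‖h‖ ^ 2)
    {d : En n} (hd : ⟪X d, d⟫ ≤ -M * ‖d‖ ^ 2) (hd0 : d ≠ 0)
    (ha₀ : 0 ≤ a₀) (ha₁ : a₀ ≤ 1) (haq : a₀ ≤ q - 1) (hq₂ : q ≤ q₂)
    {a : En n} (ha : ‖a‖ ≤ 1) :
    LinearMap.trace ℝ (En n) X + (q - 2) * ⟪X a, a⟫ ≤ K * (n + q₂) - a₀ * M := by
  set Z : En n →L[ℝ] En n := K • 1 - X with hZ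
  have hZa : ∀ h, ⟪Z h, h⟫ = K * ‖h‖ ^ 2 - ⟪X h, h⟫ := by
    intro h
    rw [hZ]
    simp only [sub_apply, smul_apply, one_apply_eq_self, inner_sub_left, real_inner_smul_left,
      real_inner_self_eq_norm_sq]
  have hZ0 : ∀ h, 0 ≤ ⟪Z h, h⟫ := fun h => by rw [hZa]; linarith [hX h]
  have htr : LinearMap.trace ℝ (En n) Z = K * n - LinearMap.trace ℝ (En n) X := by
    rw [hZ, ContinuousLinearMap.toLinearMap_sub, map_sub, ContinuousLinearMap.toLinearMap_smul,
      map_smul, ContinuousLinearMap.toLinearMap_one, LinearMap.trace_one]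
    simp
  have hdn : 0 < ‖d‖ := norm_pos_iff.mpr hd0
  have h1 : K + M ≤ LinearMap.trace ℝ (En n) Z := by
    have h2 := inner_le_trace_of_nonneg hZ0 (a := ‖d‖⁻¹ • d)
      (by rw [norm_smul, norm_inv, norm_norm, inv_mul_cancel₀ hdn.ne'])
    refine le_trans ?_ h2
    rw [map_smul, real_inner_smul_left, real_inner_smul_right, hZa]
    have h3 : (K + M) * ‖d‖ ^ 2 ≤ K * ‖d‖ ^ 2 - ⟪X d, d⟫ := by linarith
    calc K + M = ‖d‖⁻¹ * (‖d‖⁻¹ * ((K + M) * ‖d‖ ^ 2)) := by field_simp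
      _ ≤ _ := by gcongr
  have h4 := inner_le_trace_of_nonneg hZ0 ha
  have h5 := hZ0 a
  have h6 : a₀ * LinearMap.trace ℝ (En n) Z
      ≤ LinearMap.trace ℝ (En n) Z + (q - 2) * ⟪Z a, a⟫ := by
    rcases le_total 2 q with h | h
    · nlinarith
    · nlinarith
  have h7 : a₀ * (K + M) ≤ a₀ * LinearMap.trace ℝ (En n) Z := by gcongr
  have h8 : (q - 2) * ‖a‖ ^ 2 ≤ q₂ := by
    have : ‖a‖ ^ 2 ≤ 1 := pow_le_one₀ (norm_nonneg a) ha
    nlinarith [sq_nonneg ‖a‖]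
  have h9 : (q - 2) * ‖a‖ ^ 2 * K ≤ q₂ * K := by gcongr
  have h10 : 0 ≤ a₀ * K := by positivity
  rw [hZa, htr] at h6
  rw [htr] at h7
  linarith

theorem anisotropic_trace_le {X : En n →L[ℝ] En n} {K q q₂ : ℝ}
    (hK : 0 ≤ K) (hX : ∀ h, ⟪X h, h⟫ ≤ K * ‖h‖ ^ 2) (hq : 1 ≤ q) (hq₂ : q ≤ q₂)
    {a : En n} (ha : ‖a‖ ≤ 1) :
    LinearMap.trace ℝ (En n) X + (q - 2) * ⟪X a, a⟫ ≤ K * (n + q₂) := by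
  rcases subsingleton_or_nontrivial (En n) with hs | hs
  · have h1 : X = 0 := Subsingleton.elim _ _
    have : 0 ≤ K * (n + q₂) := by positivity [hq.trans hq₂]
    simpa [h1] using this
  · obtain ⟨d, hd⟩ := exists_ne (0 : En n)
    simpa using anisotropic_trace_le_of_concave_direction (M := -K) hK hX
      (by simpa using hX d) hd le_rfl zero_le_one (by linarith) hq₂ ha

end AnisotropicTrace

section IntegrationByParts

variable {n : ℕ}

theorem integrable_of_bound_on_compact {E F : Type*} [TopologicalSpace E] [T2Space E]
    [MeasurableSpace E] [OpensMeasurableSpace E] [NormedAddCommGroup F] {μ : Measure E}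
    [IsFiniteMeasureOnCompacts μ] {K : Set E} (hK : IsCompact K) {f : E → F}
    (hf : AEStronglyMeasurable f μ) {C : ℝ} (hC : ∀ x ∈ K, ‖f x‖ ≤ C)
    (h0 : ∀ x, x ∉ K → f x = 0) : Integrable f μ := by
  rw [← integrableOn_iff_integrable_of_support_subset (s := K)
    fun x hx => by_contra fun h => hx (h0 x h)]
  refine Measure.integrableOn_of_bounded (M := C) hK.measure_lt_top.ne hf ?_
  filter_upwards [ae_restrict_mem hK.measurableSet] with x hx using hC x hx

theorem measurable_gradient (f : En n → ℝ) : Measurable (gradient f) := by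
  have h := measurable_fderiv ℝ f
  exact (InnerProductSpace.toDual ℝ (En n)).symm.continuous.measurable.comp h

theorem inner_gradient_eq_fderiv (f : En n → ℝ) (x v : En n) :
    ⟪gradient f x, v⟫ = fderiv ℝ f x v := by
  rw [gradient, InnerProductSpace.toDual_symm_apply]

theorem norm_gradient_le_of_lipschitzWith {f : En n → ℝ} {C : ℝ≥0} (hf : LipschitzWith C f)
    (x : En n) : ‖gradient f x‖ ≤ C := by
  rw [gradient, LinearIsometryEquiv.norm_map]
  exact norm_fderiv_le_of_lipschitz ℝ hf

theorem gradient_eq_zero_of_notMem_tsupport {f : En n → ℝ} {x : En n} (hx : x ∉ tsupport f) :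
    gradient f x = 0 := by
  rw [gradient, fderiv_of_notMem_tsupport ℝ hx, map_zero]

/-- Integration by parts for Lipschitz functions. -/
theorem integral_lineDeriv_mul_eq_neg {f g : En n → ℝ} {C D : ℝ≥0} (hf : LipschitzWith C f)
    (hg : LipschitzWith D g) (h : HasCompactSupport f ∨ HasCompactSupport g) (v : En n) :
    ∫ x, lineDeriv ℝ f x v * g x = -∫ x, lineDeriv ℝ g x v * f x := by
  rcases h with h | h
  · rw [hg.integral_lineDeriv_mul_eq hf h v, ← integral_neg]
    simp only [lineDeriv_neg, neg_mul, neg_neg]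
  · rw [hf.integral_lineDeriv_mul_eq hg h v, ← integral_neg]
    simp only [lineDeriv_neg, neg_mul]

theorem integrable_lineDeriv_mul {f g : En n → ℝ} {C D : ℝ≥0} (hf : LipschitzWith C f)
    (hg : LipschitzWith D g) (h : HasCompactSupport f ∨ HasCompactSupport g) (v : En n) :
    Integrable (fun x => lineDeriv ℝ f x v * g x) := by
  have hm : AEStronglyMeasurable (fun x => lineDeriv ℝ f x v * g x) volume :=
    ((stronglyMeasurable_lineDeriv hf.continuous).mul
      hg.continuous.stronglyMeasurable).aestronglyMeasurable
  have hb : ∀ x, ‖lineDeriv ℝ f x v‖ ≤ C * ‖v‖ := fun x =>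
    norm_lineDeriv_le_of_lipschitz ℝ hf
  rcases h with h | h
  · obtain ⟨B, hB⟩ := h.isCompact.exists_bound_of_continuousOn hg.continuous.continuousOn
    refine integrable_of_bound_on_compact h.isCompact hm (C := C * ‖v‖ * B) (fun x hx => ?_)
      (fun x hx => ?_)
    · rw [norm_mul]
      exact mul_le_mul (hb x) (hB x hx) (norm_nonneg _) (by positivity)
    · have : f =ᶠ[𝓝 x] fun _ => 0 := notMem_tsupport_iff_eventuallyEq.mp hx
      have h2 : lineDeriv ℝ f x v = 0 := by
        rw [this.lineDeriv_eq]; simp [lineDeriv]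
      rw [h2, zero_mul]
  · obtain ⟨B, hB⟩ := h.isCompact.exists_bound_of_continuousOn hg.continuous.continuousOn
    refine integrable_of_bound_on_compact h.isCompact hm (C := C * ‖v‖ * B) (fun x hx => ?_)
      (fun x hx => ?_)
    · rw [norm_mul]
      exact mul_le_mul (hb x) (hB x hx) (norm_nonneg _) (by positivity)
    · rw [image_eq_zero_of_notMem_tsupport hx, mul_zero]

/-- The divergence theorem for a Lipschitz vector field and a Lipschitz function, one of them
compactly supported. -/
theorem integral_inner_gradient_eq {Φ : En n → En n} {ψ : En n → ℝ} {C D : ℝ≥0}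
    (hΦ : LipschitzWith C Φ) (hψ : LipschitzWith D ψ)
    (h : HasCompactSupport ψ ∨ HasCompactSupport Φ) :
    ∫ x, ⟪Φ x, gradient ψ x⟫ = -∫ x, LinearMap.trace ℝ (En n) (fderiv ℝ Φ x) * ψ x := by
  set e := EuclideanSpace.basisFun (Fin n) ℝ with he
  have hcomp : ∀ i, LipschitzWith C (fun x => ⟪e i, Φ x⟫) := by
    intro i
    refine LipschitzWith.of_dist_le_mul fun x y => ?_
    rw [Real.dist_eq, ← inner_sub_right]
    refine (norm_inner_le_norm (𝕜 := ℝ) _ _).trans ?_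
    rw [e.norm_eq_one, one_mul, ← dist_eq_norm]
    exact hΦ.dist_le_mul x y
  have h' : ∀ i, HasCompactSupport ψ ∨ HasCompactSupport (fun x => ⟪e i, Φ x⟫) := by
    intro i
    refine h.imp id fun h => ?_
    exact h.comp_left (g := fun y => ⟪e i, y⟫) (inner_zero_right _)
  have h1 : ∫ x, ⟪Φ x, gradient ψ x⟫ = ∑ i, ∫ x, lineDeriv ℝ ψ x (e i) * ⟪e i, Φ x⟫ := by
    rw [← integral_finsetSum _ fun i _ => integrable_lineDeriv_mul hψ (hcomp i) (h' i) (e i)]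
    refine integral_congr_ae ?_
    filter_upwards [hψ.ae_differentiableAt] with x hx
    rw [← e.sum_inner_mul_inner]
    refine Finset.sum_congr rfl fun i _ => ?_
    rw [hx.lineDeriv_eq_fderiv, ← inner_gradient_eq_fderiv, real_inner_comm (gradient ψ x),
      real_inner_comm (Φ x), mul_comm]
  have h2 : ∫ x, LinearMap.trace ℝ (En n) (fderiv ℝ Φ x) * ψ x
      = ∑ i, ∫ x, lineDeriv ℝ (fun x => ⟪e i, Φ x⟫) x (e i) * ψ x := by
    rw [← integral_finsetSum _ fun i _ =>
      integrable_lineDeriv_mul (hcomp i) hψ (h' i).symm (e i)]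
    refine integral_congr_ae ?_
    filter_upwards [hΦ.ae_differentiableAt] with x hx
    rw [LinearMap.trace_eq_sum_inner _ e, Finset.sum_mul]
    refine Finset.sum_congr rfl fun i _ => ?_
    congr 1
    have : HasFDerivAt (fun x => ⟪e i, Φ x⟫) ((innerSL ℝ (e i)).comp (fderiv ℝ Φ x)) x :=
      (innerSL ℝ (e i)).hasFDerivAt.comp x hx.hasFDerivAt
    rw [this.differentiableAt.lineDeriv_eq_fderiv, this.fderiv]
    rfl
  rw [h1, h2, ← Finset.sum_neg_distrib]
  exact Finset.sum_congr rfl fun i _ => integral_lineDeriv_mul_eq_neg hψ (hcomp i) (h' i) (e i)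

end IntegrationByParts

section RegularizedFlux

variable {n : ℕ}

/-- The flux `(s + |ξ|²)^{(q-2)/2} ξ`. -/
def regFlux (s q : ℝ) (ξ : En n) : En n := ((s + ‖ξ‖ ^ 2) ^ ((q - 2) / 2)) • ξ

/-- The divergence of `regFlux s p (Dv)`, in terms of `X = D²v`, `ξ = Dv` and `g = Dp`. -/
def regDiv (s q : ℝ) (X : En n →L[ℝ] En n) (ξ g : En n) : ℝ :=
  (s + ‖ξ‖ ^ 2) ^ ((q - 2) / 2) * (LinearMap.trace ℝ (En n) X
    + (q - 2) * (⟪X ξ, ξ⟫ / (s + ‖ξ‖ ^ 2)) + 1 / 2 * Real.log (s + ‖ξ‖ ^ 2) * ⟪g, ξ⟫)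

theorem trace_fderiv_regFlux {s : ℝ} (hs : 0 < s) {p : En n → ℝ} {G : En n → En n} {x : En n}
    (hp : DifferentiableAt ℝ p x) {X : En n →L[ℝ] En n} (hX : HasFDerivAt G X x) :
    LinearMap.trace ℝ (En n) (fderiv ℝ (fun x => regFlux s (p x) (G x)) x)
      = regDiv s (p x) X (G x) (gradient p x) := by
  have ht : 0 < s + ‖G x‖ ^ 2 := by positivity
  have h1 := (hX.norm_sq).const_add s
  have h2 := (hp.hasFDerivAt.sub_const 2).mul_const (1 / 2 : ℝ)
  have h2' : HasFDerivAt (fun x => (p x - 2) / 2) ((1 / 2 : ℝ) • fderiv ℝ p x) x := by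
    refine h2.congr_of_eventuallyEq (Eventually.of_forall fun y => ?_)
    simp only; ring
  have h3 := (h1.rpow h2' ht).smul hX
  have h4 : fderiv ℝ (fun x => regFlux s (p x) (G x)) x = _ := h3.fderiv
  rw [h4, regDiv, ContinuousLinearMap.toLinearMap_add, map_add,
    ContinuousLinearMap.toLinearMap_smul, map_smul]
  have h5 : ∀ φ : En n →L[ℝ] ℝ, LinearMap.trace ℝ (En n)
      (φ.smulRight (G x) : En n →L[ℝ] En n) = φ (G x) := by
    intro φ
    set e := EuclideanSpace.basisFun (Fin n) ℝ with he
    rw [LinearMap.trace_eq_sum_inner _ e]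
    conv_rhs => rw [← e.sum_repr' (G x), map_sum]
    refine Finset.sum_congr rfl fun i _ => ?_
    simp [real_inner_smul_right, mul_comm]
  rw [h5]
  simp only [add_apply, smul_apply, ContinuousLinearMap.comp_apply, smul_eq_mul,
    inner_gradient_eq_fderiv, innerSL_apply_apply]
  rw [Real.rpow_sub_one ht.ne', real_inner_comm]
  field_simp
  ring

theorem exists_lipschitzWith_regFlux {s : ℝ} (hs : 0 < s) {p : En n → ℝ} {G : En n → En n}
    {C D : ℝ≥0} (hp : LipschitzWith C p) (hG : LipschitzWith D G) {B L : ℝ}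
    (hpB : ∀ x, |p x| ≤ B) (hGL : ∀ x, ‖G x‖ ≤ L) :
    ∃ A, LipschitzWith A (fun x => regFlux s (p x) (G x)) := by
  have h1 : ContDiff ℝ 1 (fun z : ℝ × En n => regFlux s z.1 z.2) := by
    have h2 : ContDiff ℝ 1 (fun z : ℝ × En n => s + ‖z.2‖ ^ 2) :=
      contDiff_const.add (contDiff_snd.norm_sq ℝ)
    exact (h2.rpow ((contDiff_fst.sub contDiff_const).div_const 2)
      fun z => by positivity).smul contDiff_snd
  obtain ⟨A, hA⟩ := h1.contDiffOn.exists_lipschitzOnWith one_ne_zero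
    (convex_closedBall (0 : ℝ × En n) (max B L)) (isCompact_closedBall _ _)
  have h2 := hA.comp (hp.prodMk hG).lipschitzOnWith (s := univ) fun x _ => by
    rw [mem_closedBall_zero_iff, Prod.norm_def]
    exact max_le_max (hpB x) (hGL x)
  exact ⟨_, lipschitzOnWith_univ.mp h2⟩

theorem regFlux_zero (q : ℝ) (ξ : En n) : regFlux 0 q ξ = ‖ξ‖ ^ (q - 2) • ξ := by
  rw [regFlux, zero_add, ← Real.rpow_natCast, ← Real.rpow_mul (norm_nonneg ξ)]
  congr 2
  push_cast; ring

theorem tendsto_regFlux (q : ℝ) (ξ : En n) :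
    Tendsto (fun s => regFlux s q ξ) (𝓝[>] 0) (𝓝 (regFlux 0 q ξ)) := by
  rcases eq_or_ne ξ 0 with rfl | hξ
  · simp [regFlux]
  · have hn : 0 < ‖ξ‖ := norm_pos_iff.mpr hξ
    have h1 : ContinuousAt (fun s : ℝ => regFlux s q ξ) 0 := by
      unfold regFlux
      refine ContinuousAt.smul (ContinuousAt.rpow (by fun_prop) (by fun_prop) (Or.inl ?_))
        (by fun_prop)
      positivity
    exact h1.tendsto.mono_left nhdsWithin_le_nhds

theorem norm_le_sqrt_reg (s : ℝ) (hs : 0 ≤ s) (ξ : En n) : ‖ξ‖ ≤ (s + ‖ξ‖ ^ 2) ^ (1 / 2 : ℝ) := by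
  rw [← Real.sqrt_eq_rpow]
  exact Real.le_sqrt_of_sq_le (by linarith)

theorem norm_regFlux_le {s q q₂ L : ℝ} {ξ : En n} (hs : 0 ≤ s) (hs1 : s ≤ 1) (hq : 1 ≤ q)
    (hq₂ : q ≤ q₂) (hL : ‖ξ‖ ≤ L) : ‖regFlux s q ξ‖ ≤ (1 + L ^ 2) ^ q₂ := by
  have hL0 : 0 ≤ L := (norm_nonneg ξ).trans hL
  rcases eq_or_ne ξ 0 with rfl | hξ
  · simp only [regFlux, smul_zero, norm_zero]; positivity
  have hn : 0 < ‖ξ‖ := norm_pos_iff.mpr hξ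
  have ht : 0 < s + ‖ξ‖ ^ 2 := by positivity
  rw [regFlux, norm_smul, Real.norm_eq_abs, abs_of_pos (Real.rpow_pos_of_pos ht _)]
  calc (s + ‖ξ‖ ^ 2) ^ ((q - 2) / 2) * ‖ξ‖
      ≤ (s + ‖ξ‖ ^ 2) ^ ((q - 2) / 2) * (s + ‖ξ‖ ^ 2) ^ (1 / 2 : ℝ) := by
        gcongr; exact norm_le_sqrt_reg s hs ξ
    _ = (s + ‖ξ‖ ^ 2) ^ ((q - 1) / 2) := by rw [← Real.rpow_add ht]; ring_nf
    _ ≤ (1 + L ^ 2) ^ ((q - 1) / 2) := by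
        apply Real.rpow_le_rpow ht.le _ (by linarith); gcongr
    _ ≤ (1 + L ^ 2) ^ q₂ :=
        Real.rpow_le_rpow_of_exponent_le (by nlinarith) (by linarith)

theorem rpow_mul_abs_log_le {t T a a₁ a₂ : ℝ} (ht : 0 < t) (htT : t ≤ T) (hT : 1 ≤ T)
    (ha₁ : 0 < a₁) (ha : a₁ ≤ a) (ha₂ : a ≤ a₂) :
    t ^ a * |Real.log t| ≤ 1 / a₁ + T ^ a₂ * T := by
  have hTpos : 0 < T ^ a₂ * T := by positivity
  rcases le_total t 1 with h | h
  · have h1 := Real.abs_log_mul_self_rpow_lt t a₁ ht h ha₁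
    rw [abs_mul, abs_of_pos (Real.rpow_pos_of_pos ht _)] at h1
    have h2 : t ^ a ≤ t ^ a₁ := Real.rpow_le_rpow_of_exponent_ge ht h ha
    have h3 : t ^ a * |Real.log t| ≤ t ^ a₁ * |Real.log t| := by gcongr
    linarith
  · have h1 : t ^ a ≤ T ^ a₂ := (Real.rpow_le_rpow_of_exponent_le h ha₂).trans
      (Real.rpow_le_rpow ht.le htT (by linarith))
    have h2 : |Real.log t| ≤ T := by
      rw [abs_of_nonneg (Real.log_nonneg h)]
      have := Real.log_le_sub_one_of_pos ht
      linarith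
    have h3 : t ^ a * |Real.log t| ≤ T ^ a₂ * T := by gcongr
    have : 0 < 1 / a₁ := by positivity
    linarith

/-- A bound from above for the divergence of the regularized flux, uniform in `s`. -/
theorem regDiv_le {s q q₁ q₂ B L P : ℝ} {X : En n →L[ℝ] En n} {ξ g : En n} (hs : 0 < s)
    (hs1 : s ≤ 1) (hq₁ : 1 < q₁) (hq₁' : q₁ ≤ 2) (hq : q₁ ≤ q) (hq₂ : q ≤ q₂) (hB : 0 ≤ B)
    (hξ : ‖ξ‖ ≤ L) (hg : ‖g‖ ≤ P)
    (hX : ∀ a : En n, ‖a‖ ≤ 1 →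
      LinearMap.trace ℝ (En n) X + (q - 2) * ⟪X a, a⟫ ≤ B * ‖ξ‖ ^ (2 - q₁)) :
    regDiv s q X ξ g ≤ B * (1 + L ^ 2) ^ q₂
      + P * (1 / ((q₁ - 1) / 2) + (1 + L ^ 2) ^ q₂ * (1 + L ^ 2)) := by
  have hP0 : 0 ≤ P := (norm_nonneg g).trans hg
  set t := s + ‖ξ‖ ^ 2 with htdef
  have ht : 0 < t := by positivity
  have htT : t ≤ 1 + L ^ 2 := by rw [htdef]; gcongr
  have hT1 : 1 ≤ 1 + L ^ 2 := by nlinarith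
  have hr := norm_le_sqrt_reg s hs.le ξ
  rw [← htdef] at hr
  have h1 : LinearMap.trace ℝ (En n) X + (q - 2) * (⟪X ξ, ξ⟫ / t) ≤ B * t ^ ((2 - q₁) / 2) := by
    have hsq : (t ^ (1 / 2 : ℝ)) ^ 2 = t := by
      rw [← Real.sqrt_eq_rpow, Real.sq_sqrt ht.le]
    have hsp : 0 < t ^ (1 / 2 : ℝ) := Real.rpow_pos_of_pos ht _
    have h2 := hX ((t ^ (1 / 2 : ℝ))⁻¹ • ξ) (by
      rw [norm_smul, norm_inv, Real.norm_eq_abs, abs_of_pos hsp]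
      exact inv_mul_le_one_of_le₀ hr hsp.le)
    have h3 : ⟪X ((t ^ (1 / 2 : ℝ))⁻¹ • ξ), (t ^ (1 / 2 : ℝ))⁻¹ • ξ⟫ = ⟪X ξ, ξ⟫ / t := by
      rw [map_smul, real_inner_smul_left, real_inner_smul_right]
      conv_rhs => rw [← hsq]
      field_simp
    rw [h3] at h2
    refine h2.trans ?_
    gcongr
    calc ‖ξ‖ ^ (2 - q₁) ≤ (t ^ (1 / 2 : ℝ)) ^ (2 - q₁) :=
          Real.rpow_le_rpow (norm_nonneg ξ) hr (by linarith)
      _ = t ^ ((2 - q₁) / 2) := by rw [← Real.rpow_mul ht.le]; ring_nf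
  have h4 : 1 / 2 * Real.log t * ⟪g, ξ⟫ ≤ |Real.log t| * P * t ^ (1 / 2 : ℝ) := by
    have h5 : |⟪g, ξ⟫| ≤ P * t ^ (1 / 2 : ℝ) :=
      (abs_real_inner_le_norm g ξ).trans (by gcongr)
    calc 1 / 2 * Real.log t * ⟪g, ξ⟫ ≤ |1 / 2 * Real.log t * ⟪g, ξ⟫| := le_abs_self _
      _ = 1 / 2 * |Real.log t| * |⟪g, ξ⟫| := by rw [abs_mul, abs_mul]; norm_num
      _ ≤ 1 * |Real.log t| * (P * t ^ (1 / 2 : ℝ)) := by gcongr; norm_num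
      _ = _ := by ring
  have h6 : regDiv s q X ξ g ≤ t ^ ((q - 2) / 2) *
      (B * t ^ ((2 - q₁) / 2) + |Real.log t| * P * t ^ (1 / 2 : ℝ)) := by
    rw [regDiv, ← htdef]
    gcongr
  refine h6.trans ?_
  have h7 : t ^ ((q - 2) / 2) * t ^ ((2 - q₁) / 2) ≤ (1 + L ^ 2) ^ q₂ := by
    rw [← Real.rpow_add ht]
    calc t ^ ((q - 2) / 2 + (2 - q₁) / 2) ≤ (1 + L ^ 2) ^ ((q - 2) / 2 + (2 - q₁) / 2) :=
          Real.rpow_le_rpow ht.le htT (by linarith)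
      _ ≤ _ := Real.rpow_le_rpow_of_exponent_le hT1 (by linarith)
  have h8 : t ^ ((q - 2) / 2) * t ^ (1 / 2 : ℝ) * |Real.log t|
      ≤ 1 / ((q₁ - 1) / 2) + (1 + L ^ 2) ^ q₂ * (1 + L ^ 2) := by
    rw [← Real.rpow_add ht]
    exact rpow_mul_abs_log_le ht htT hT1 (by linarith) (by linarith) (by linarith)
  calc t ^ ((q - 2) / 2) * (B * t ^ ((2 - q₁) / 2) + |Real.log t| * P * t ^ (1 / 2 : ℝ))
      = B * (t ^ ((q - 2) / 2) * t ^ ((2 - q₁) / 2))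
        + P * (t ^ ((q - 2) / 2) * t ^ (1 / 2 : ℝ) * |Real.log t|) := by ring
    _ ≤ _ := by gcongr

theorem tendsto_regDiv (q : ℝ) (X : En n →L[ℝ] En n) {ξ : En n} (g : En n) (hξ : ξ ≠ 0) :
    Tendsto (fun s => regDiv s q X ξ g) (𝓝[>] 0) (𝓝 (‖ξ‖ ^ (q - 2) *
      (LinearMap.trace ℝ (En n) X + (q - 2) * (⟪X ξ, ξ⟫ / ‖ξ‖ ^ 2)
        + Real.log ‖ξ‖ * ⟪g, ξ⟫))) := by
  have hn : 0 < ‖ξ‖ := norm_pos_iff.mpr hξ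
  have h0 : (0 : ℝ) + ‖ξ‖ ^ 2 ≠ 0 := by positivity
  have h1 : ContinuousAt (fun s : ℝ => regDiv s q X ξ g) 0 := by
    unfold regDiv
    refine ContinuousAt.mul (ContinuousAt.rpow (by fun_prop) (by fun_prop) (Or.inl h0)) ?_
    refine ContinuousAt.add (ContinuousAt.add (by fun_prop) ?_) ?_
    · exact continuousAt_const.mul (ContinuousAt.div (by fun_prop) (by fun_prop) h0)
    · exact (continuousAt_const.mul (ContinuousAt.log (f := fun s : ℝ => s + ‖ξ‖ ^ 2)
        (by fun_prop) h0)).mul continuousAt_const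
  have h2 := h1.tendsto.mono_left (nhdsWithin_le_nhds (s := Ioi 0))
  convert h2 using 2
  rw [regDiv, zero_add, Real.log_pow, ← Real.rpow_natCast ‖ξ‖ 2, ← Real.rpow_mul (norm_nonneg ξ)]
  push_cast
  congr 2 <;> ring_nf

end RegularizedFlux

section PointwiseEstimates

variable {n : ℕ}

theorem one_le_one_add_sq (a : ℝ) : 1 ≤ 1 + a ^ 2 := le_add_of_nonneg_right (sq_nonneg a)

theorem le_one_add_sq (a : ℝ) : a ≤ 1 + a ^ 2 := by nlinarith [sq_nonneg (a - 1)]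

theorem IsContactPoint.anisotropic_trace_le {u v : En n → ℝ} {c R : ℝ} {j : ℕ} {x y : En n}
    (hc : 0 < c) (hR : R ≤ 1) (h : IsContactPoint u v c j R x y) {G : En n → En n}
    (hG : ∀ x, HasGradientAt v (G x) x) {X : En n →L[ℝ] En n} (hX : HasFDerivAt G X x)
    {q q₁ q₂ : ℝ} (hj : (2 - q₁) * (2 * j + 3) ≤ 2 * j + 2)
    (hq : 1 ≤ q) (hq₂ : q ≤ q₂) {a : En n} (ha : ‖a‖ ≤ 1) :
    LinearMap.trace ℝ (En n) X + (q - 2) * ⟪X a, a⟫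
      ≤ 10 * (j + 2) ^ 2 * c / (2 * (j + 2) * c) ^ (2 - q₁) * (n + q₂) * ‖G x‖ ^ (2 - q₁) := by
  have h1 := _root_.anisotropic_trace_le (by positivity) (h.inner_hessian_le hc.le hG hX) hq hq₂ ha
  refine h1.trans ?_
  have hgr : ‖G x‖ = 2 * (j + 2) * c * ‖x - y‖ ^ (2 * j + 3) := by
    rw [h.gradient_eq hc.le (hG x), norm_powKernelGrad hc.le]
  have hz1 : ‖x - y‖ ≤ 1 := h.1.trans hR
  have hpos : 0 < (2 * ((j : ℝ) + 2) * c) ^ (2 - q₁) := by positivity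
  have h2 : (‖x - y‖ ^ 2) ^ (j + 1) ≤ (‖x - y‖ ^ (2 * j + 3)) ^ (2 - q₁) := by
    rcases (norm_nonneg (x - y)).eq_or_lt with h0 | h0
    · rw [← h0]; simp only [ne_eq, OfNat.ofNat_ne_zero, not_false_eq_true, zero_pow,
        Nat.add_eq_zero_iff, one_ne_zero, and_false]
      positivity
    · rw [← pow_mul, ← Real.rpow_natCast, ← Real.rpow_natCast, ← Real.rpow_mul h0.le]
      apply Real.rpow_le_rpow_of_exponent_ge h0 hz1
      push_cast
      linarith
  rw [hgr, Real.mul_rpow (x := 2 * ((j : ℝ) + 2) * c) (by positivity) (by positivity)]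
  have h3 : 0 ≤ (n : ℝ) + q₂ := by positivity [hq.trans hq₂]
  calc 10 * ((j : ℝ) + 2) ^ 2 * c * (‖x - y‖ ^ 2) ^ (j + 1) * (n + q₂)
      ≤ 10 * ((j : ℝ) + 2) ^ 2 * c * (‖x - y‖ ^ (2 * j + 3)) ^ (2 - q₁) * (n + q₂) := by gcongr
    _ = _ := by
      generalize (2 * ((j : ℝ) + 2) * c) ^ (2 - q₁) = W at *
      generalize (‖x - y‖ ^ (2 * j + 3)) ^ (2 - q₁) = Y at *
      field_simp

/-- The operator evaluated at the regularized function is almost nonpositive at contact points. -/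
theorem IsContactPoint.operator_le {p u v : En n → ℝ} {U : Set (En n)}
    (hu : IsViscositySupersolution p u U) {c R : ℝ} {j : ℕ} {x y : En n} (hc : 0 ≤ c)
    (h : IsContactPoint u v c j R x y) (hy : y ∈ U) {G : En n → En n}
    (hG : ∀ x, HasGradientAt v (G x) x) {X : En n →L[ℝ] En n} (hX : HasFDerivAt G X x)
    (hξ : G x ≠ 0) {L q₁ q₂ ω : ℝ} {P : ℝ≥0} (hq₁ : 1 < q₁) (hq : ∀ x, q₁ ≤ p x ∧ p x ≤ q₂)
    (hP : LipschitzWith P p) (hL : ‖G x‖ ≤ L) (hω : ‖gradient p x - gradient p y‖ ≤ ω) :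
    ‖G x‖ ^ (p x - 2) * (LinearMap.trace ℝ (En n) X
        + (p x - 2) * (⟪X (G x), G x⟫ / ‖G x‖ ^ 2) + Real.log ‖G x‖ * ⟪gradient p x, G x⟫)
      ≤ 5 * (j + 2) * P ^ 2 / (q₁ - 1) * (1 + L ^ 2) ^ q₂ * R
        + (1 / (q₁ - 1) + (1 + L ^ 2) ^ q₂ * (1 + L ^ 2)) * ω := by
  have hgr : ‖G x‖ = 2 * (j + 2) * c * ‖x - y‖ ^ (2 * j + 3) := by
    rw [h.gradient_eq hc (hG x), norm_powKernelGrad hc]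
  have hx1 : 0 < p x - 1 := by linarith [(hq x).1]
  have hy1 : 0 < p y - 1 := by linarith [(hq y).1]
  set A := (p x - 1) / (p y - 1) with hA
  have hA0 : 0 < A := by positivity
  have hθ : (1 + (√A - 1)) ^ 2 * (p y - 1) = p x - 1 := by
    rw [add_sub_cancel, Real.sq_sqrt hA0.le, hA]; field_simp
  have hvis := h.viscosity_ineq hu hc hy hG hX hξ hθ
  have hn : 0 < ‖G x‖ := norm_pos_iff.mpr hξ
  have hω0 : 0 ≤ ω := (norm_nonneg _).trans hω
  have hθsq : (√A - 1) ^ 2 ≤ (A - 1) ^ 2 := by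
    have h1 : A - 1 = (√A - 1) * (√A + 1) := by
      nlinarith [Real.sq_sqrt hA0.le]
    rw [h1, mul_pow]
    have h2 : 1 ≤ (√A + 1) ^ 2 := by nlinarith [Real.sqrt_nonneg A]
    nlinarith [sq_nonneg (√A - 1)]
  have hpxy : (p x - p y) ^ 2 ≤ P ^ 2 * ‖x - y‖ ^ 2 := by
    have := hP.dist_le_mul x y
    rw [Real.dist_eq, dist_eq_norm] at this
    rw [← sq_abs, ← mul_pow]
    gcongr
  have h3 : (p y - 1) * (√A - 1) ^ 2 ≤ P ^ 2 * ‖x - y‖ ^ 2 / (q₁ - 1) := by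
    calc (p y - 1) * (√A - 1) ^ 2 ≤ (p y - 1) * (A - 1) ^ 2 := by gcongr
      _ = (p x - p y) ^ 2 / (p y - 1) := by rw [hA]; field_simp; ring
      _ ≤ _ := by
        apply div_le_div₀ (by positivity) hpxy (by linarith) (by linarith [(hq y).1])
  have h4 : (p y - 1) * (10 * ((j : ℝ) + 2) ^ 2 * c * (‖x - y‖ ^ 2) ^ (j + 1)) * (√A - 1) ^ 2
      ≤ 5 * (j + 2) * P ^ 2 / (q₁ - 1) * R * ‖G x‖ := by
    have hq1 : 0 < q₁ - 1 := by linarith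
    calc (p y - 1) * (10 * ((j : ℝ) + 2) ^ 2 * c * (‖x - y‖ ^ 2) ^ (j + 1)) * (√A - 1) ^ 2
        = (10 * ((j : ℝ) + 2) ^ 2 * c * (‖x - y‖ ^ 2) ^ (j + 1))
          * ((p y - 1) * (√A - 1) ^ 2) := by ring
      _ ≤ (10 * ((j : ℝ) + 2) ^ 2 * c * (‖x - y‖ ^ 2) ^ (j + 1))
          * (P ^ 2 * ‖x - y‖ ^ 2 / (q₁ - 1)) := by gcongr
      _ = 5 * (j + 2) * P ^ 2 / (q₁ - 1) * ‖x - y‖ * ‖G x‖ := by rw [hgr]; field_simp; ring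
      _ ≤ _ := by gcongr; exact h.1
  have h5 : Real.log ‖G x‖ * ⟪gradient p x, G x⟫ ≤ Real.log ‖G x‖ * ⟪gradient p y, G x⟫
      + |Real.log ‖G x‖| * ω * ‖G x‖ := by
    have h6 : Real.log ‖G x‖ * ⟪gradient p x, G x⟫ - Real.log ‖G x‖ * ⟪gradient p y, G x⟫
        = Real.log ‖G x‖ * ⟪gradient p x - gradient p y, G x⟫ := by rw [inner_sub_left]; ring
    have h7 : Real.log ‖G x‖ * ⟪gradient p x - gradient p y, G x⟫
        ≤ |Real.log ‖G x‖| * (ω * ‖G x‖) := by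
      refine (le_abs_self _).trans ?_
      rw [abs_mul]
      gcongr
      exact (abs_real_inner_le_norm _ _).trans (by gcongr)
    linarith
  have h8 : ‖G x‖ ^ (p x - 2) * ‖G x‖ ≤ (1 + L ^ 2) ^ q₂ := by
    have := norm_regFlux_le (s := 0) le_rfl zero_le_one (by linarith [(hq x).1]) (hq x).2 hL
    rwa [regFlux_zero, norm_smul, Real.norm_eq_abs,
      abs_of_pos (Real.rpow_pos_of_pos hn _)] at this
  have h9 : ‖G x‖ ^ (p x - 2) * ‖G x‖ * |Real.log ‖G x‖|
      ≤ 1 / (q₁ - 1) + (1 + L ^ 2) ^ q₂ * (1 + L ^ 2) := by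
    rw [← Real.rpow_add_one hn.ne']
    exact rpow_mul_abs_log_le hn (hL.trans (le_one_add_sq L)) (one_le_one_add_sq L) (by linarith)
      (by linarith [(hq x).1]) (by linarith [(hq x).2])
  have hR : 0 ≤ R := (norm_nonneg _).trans h.1
  have hq1 : 0 < q₁ - 1 := by linarith
  calc _ ≤ ‖G x‖ ^ (p x - 2) * (5 * (j + 2) * P ^ 2 / (q₁ - 1) * R * ‖G x‖
        + |Real.log ‖G x‖| * ω * ‖G x‖) :=
        mul_le_mul_of_nonneg_left (by linarith) (by positivity)
    _ = 5 * (j + 2) * P ^ 2 / (q₁ - 1) * (‖G x‖ ^ (p x - 2) * ‖G x‖) * R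
        + (‖G x‖ ^ (p x - 2) * ‖G x‖ * |Real.log ‖G x‖|) * ω := by ring
    _ ≤ _ := by gcongr

theorem tendsto_max_regDiv {q e : ℝ} {X : En n →L[ℝ] En n} {ξ g : En n} (he : 0 ≤ e)
    (h0 : ξ = 0 → LinearMap.trace ℝ (En n) X ≤ 0)
    (h1 : ξ ≠ 0 → ‖ξ‖ ^ (q - 2) * (LinearMap.trace ℝ (En n) X + (q - 2) * (⟪X ξ, ξ⟫ / ‖ξ‖ ^ 2)
        + Real.log ‖ξ‖ * ⟪g, ξ⟫) ≤ e) :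
    Tendsto (fun s => max (regDiv s q X ξ g) e) (𝓝[>] 0) (𝓝 e) := by
  by_cases hξ : ξ = 0
  · refine tendsto_const_nhds.congr' ?_
    filter_upwards [self_mem_nhdsWithin] with s hs
    have hs0 : (0 : ℝ) < s := hs
    rw [eq_comm, max_eq_right]
    refine le_trans ?_ he
    rw [regDiv, hξ]
    simp only [map_zero, inner_zero_right, norm_zero, zero_div, mul_zero, add_zero]
    exact mul_nonpos_of_nonneg_of_nonpos (by positivity) (h0 hξ)
  · have := (tendsto_regDiv q X g hξ).max (tendsto_const_nhds (x := e))
    rwa [max_eq_right (h1 hξ)] at this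

/-- Regularization of a viscosity supersolution: pointwise form. -/
theorem exists_pointwise_regularization {p u : En n → ℝ} {U : Set (En n)}
    (hvisc : IsViscositySupersolution p u U) {L P : ℝ≥0} (hu : LipschitzWith L u)
    (hP : LipschitzWith P p) {q₁ q₂ : ℝ} (hq₁ : 1 < q₁) (hq₁' : q₁ ≤ 2)
    (hq : ∀ x, q₁ ≤ p x ∧ p x ≤ q₂) :
    ∃ A : ℝ, 0 ≤ A ∧ ∀ R ω δ : ℝ, 0 < R → R ≤ 1 → 0 < δ →
      (∀ x y, ‖x - y‖ ≤ R → ‖gradient p x - gradient p y‖ ≤ ω) →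
      ∃ (v : En n → ℝ) (G : En n → En n), LipschitzWith L v ∧ (∀ x, v x ≤ u x) ∧
        (∀ x, u x - L * R - δ ≤ v x) ∧ (∀ x, HasGradientAt v (G x) x) ∧
        (∃ D, LipschitzWith D G) ∧ ∃ C : ℝ, ∀ x X, HasFDerivAt G X x →
          (∀ y, ‖x - y‖ ≤ R → y ∈ U) →
          (∀ s, 0 < s → s ≤ 1 → regDiv s (p x) X (G x) (gradient p x) ≤ C) ∧
          Tendsto (fun s => max (regDiv s (p x) X (G x) (gradient p x)) (A * (R + ω)))
            (𝓝[>] 0) (𝓝 (A * (R + ω))) := by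
  obtain ⟨j, hj⟩ : ∃ j : ℕ, (2 - q₁) * (2 * j + 3) ≤ 2 * j + 2 := by
    obtain ⟨j, hj⟩ := exists_nat_ge (1 / (q₁ - 1))
    refine ⟨j, ?_⟩
    rw [div_le_iff₀ (by linarith)] at hj
    nlinarith
  have hq1 : 0 < q₁ - 1 := by linarith
  set A₁ := 5 * ((j : ℝ) + 2) * P ^ 2 / (q₁ - 1) * (1 + (L : ℝ) ^ 2) ^ q₂ with hA₁
  set A₂ := 1 / (q₁ - 1) + (1 + (L : ℝ) ^ 2) ^ q₂ * (1 + (L : ℝ) ^ 2) with hA₂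
  have hA₁0 : 0 ≤ A₁ := by positivity
  have hA₂0 : 0 ≤ A₂ := by positivity
  refine ⟨A₁ + A₂, by positivity, fun R ω δ hR hR1 hδ hω => ?_⟩
  have hω0 : 0 ≤ ω := by simpa using hω 0 0 (by simpa using hR.le)
  set c := ((L : ℝ) + 1) / R ^ (2 * j + 3) with hc
  have hc0 : 0 < c := by positivity
  set K := 10 * ((j : ℝ) + 2) ^ 2 * c * ((R + 1) ^ 2) ^ (j + 1) with hK
  have hK0 : 0 ≤ K := by positivity
  set T := 1 + (L : ℝ) ^ 2 with hT
  have hq₂0 : 0 ≤ q₂ := by linarith [(hq 0).1, (hq 0).2]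
  set M := (K * (n + q₂) + P * (1 / 1 + T ^ (1 : ℝ) * T)) / (q₁ - 1) + 2 * L ^ 2 / δ + 1 with hM
  have hM0 : 0 < M := by positivity
  obtain ⟨v, G, hvL, hvu, huv, hG, hGD, hsc, hdich⟩ :=
    exists_regularization hu j hc0 hR (M := M) (by rw [hc]; field_simp; linarith) hM0
  refine ⟨v, G, hvL, hvu, fun x => ?_, hG, hGD, ?_⟩
  · have h1 : 2 * (L : ℝ) ^ 2 / M ≤ δ := by
      rw [div_le_iff₀ hM0]
      have h2 : 2 * (L : ℝ) ^ 2 / δ ≤ M := by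
        rw [hM]
        have : 0 ≤ (K * (n + q₂) + P * (1 / 1 + T ^ (1 : ℝ) * T)) / (q₁ - 1) := by positivity
        linarith
      rw [div_le_iff₀ hδ] at h2
      linarith
    linarith [huv x]
  set B := 10 * ((j : ℝ) + 2) ^ 2 * c / (2 * (j + 2) * c) ^ (2 - q₁) * (n + q₂) with hB
  have hB0 : 0 ≤ B := by positivity
  refine ⟨B * (1 + (L : ℝ) ^ 2) ^ q₂
      + P * (1 / ((q₁ - 1) / 2) + (1 + (L : ℝ) ^ 2) ^ q₂ * (1 + (L : ℝ) ^ 2)),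
      fun x X hX hU => ?_⟩
  have hGL : ‖G x‖ ≤ L := norm_le_of_hasGradientAt_of_lipschitzWith hvL (hG x)
  have hpP : ‖gradient p x‖ ≤ P := norm_gradient_le_of_lipschitzWith hP x
  rcases hdich x with ⟨y, hy⟩ | ⟨d, hd0, hd⟩
  · have htr := fun a ha => hy.anisotropic_trace_le hc0 hR1 hG hX hj
      (q := p x) (a := a) (by linarith [(hq x).1]) (hq x).2 ha
    refine ⟨fun s hs hs1 => regDiv_le hs hs1 hq₁ hq₁' (hq x).1 (hq x).2 hB0 hGL hpP htr,
      tendsto_max_regDiv (by positivity) (fun hx0 => ?_) (fun hx0 => ?_)⟩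
    · have hz : x - y = 0 := by
        have h1 := norm_powKernelGrad hc0.le (z := x - y) (j := j)
        rw [← hy.gradient_eq hc0.le (hG x), hx0, norm_zero, eq_comm] at h1
        by_contra hne
        have : 0 < ‖x - y‖ := norm_pos_iff.mpr hne
        have : 0 < 2 * ((j : ℝ) + 2) * c * ‖x - y‖ ^ (2 * j + 3) := by positivity
        linarith
      have h2 := anisotropic_trace_le (q := p x) (a := 0) le_rfl (fun h => by
        simpa [hz] using hy.inner_hessian_le hc0.le hG hX h) (by linarith [(hq x).1]) (hq x).2
        (by simp)
      simpa using h2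
    · have h1 := hy.operator_le hvisc hc0.le (hU y hy.1) hG hX hx0 hq₁ hq hP hGL (hω x y hy.1)
      refine h1.trans ?_
      nlinarith [mul_nonneg hA₁0 hω0, mul_nonneg hA₂0 hR.le]
  · have hXK : ∀ h, ⟪X h, h⟫ ≤ K * ‖h‖ ^ 2 := fun h =>
      inner_hessian_le_of_semiconcave hG hX (hsc x) h
    have hXd : ⟪X d, d⟫ ≤ -M * ‖d‖ ^ 2 := by
      refine inner_hessian_le hG hX (q := fun _ => -M * ‖d‖ ^ 2 / 2) tendsto_const_nhds ?_
      filter_upwards [Ioo_mem_nhdsGT (zero_lt_one' ℝ)] with t ht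
      have := hd t ht.1.le ht.2.le
      linarith
    have htr : ∀ a : En n, ‖a‖ ≤ 1 → LinearMap.trace ℝ (En n) X + (p x - 2) * ⟪X a, a⟫
        ≤ - (P * (1 / 1 + T ^ (1 : ℝ) * T)) := by
      intro a ha
      refine (anisotropic_trace_le_of_concave_direction (a₀ := q₁ - 1) (q₂ := q₂) hK0 hXK hXd hd0
        hq1.le (by linarith) (by linarith [(hq x).1]) (hq x).2 ha).trans ?_
      have h1 : (q₁ - 1) * M = K * (n + q₂) + P * (1 / 1 + T ^ (1 : ℝ) * T)
          + (q₁ - 1) * (2 * L ^ 2 / δ + 1) := by rw [hM]; field_simp; ring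
      have h2 : 0 ≤ (q₁ - 1) * (2 * (L : ℝ) ^ 2 / δ + 1) := by positivity
      rw [h1]
      linarith
    have hneg : - ((P : ℝ) * (1 / 1 + T ^ (1 : ℝ) * T)) ≤ 0 := by
      rw [neg_nonpos]; positivity
    refine ⟨fun s hs hs1 => ?_,
      tendsto_max_regDiv (by positivity) (fun hx0 => ?_) (fun hx0 => ?_)⟩
    · refine regDiv_le hs hs1 hq₁ hq₁' (hq x).1 (hq x).2 hB0 hGL hpP fun a ha => ?_
      exact ((htr a ha).trans hneg).trans (by positivity)
    · simpa using (htr 0 (by simp)).trans hneg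
    · have hn : 0 < ‖G x‖ := norm_pos_iff.mpr hx0
      have h1 := htr (‖G x‖⁻¹ • G x) (by
        rw [norm_smul, norm_inv, norm_norm, inv_mul_cancel₀ hn.ne'])
      have h2 : ⟪X (‖G x‖⁻¹ • G x), ‖G x‖⁻¹ • G x⟫ = ⟪X (G x), G x⟫ / ‖G x‖ ^ 2 := by
        rw [map_smul, real_inner_smul_left, real_inner_smul_right]; field_simp
      rw [h2] at h1
      have h3 : ‖G x‖ * |Real.log ‖G x‖| ≤ 1 / 1 + T ^ (1 : ℝ) * T := by
        simpa using rpow_mul_abs_log_le (a := 1) hn (hGL.trans (le_one_add_sq _))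
          (one_le_one_add_sq _) one_pos le_rfl le_rfl
      have h4 : Real.log ‖G x‖ * ⟪gradient p x, G x⟫ ≤ P * (1 / 1 + T ^ (1 : ℝ) * T) := by
        calc Real.log ‖G x‖ * ⟪gradient p x, G x⟫
            ≤ |Real.log ‖G x‖| * |⟪gradient p x, G x⟫| := by
              rw [← abs_mul]; exact le_abs_self _
          _ ≤ |Real.log ‖G x‖| * (P * ‖G x‖) := by
              gcongr; exact (abs_real_inner_le_norm _ _).trans (by gcongr)
          _ = P * (‖G x‖ * |Real.log ‖G x‖|) := by ring
          _ ≤ _ := by gcongr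
      refine le_trans (mul_nonpos_of_nonneg_of_nonpos (by positivity) ?_)
        (by positivity : 0 ≤ (A₁ + A₂) * (R + ω))
      linarith

end PointwiseEstimates

section IntegralRegularization

variable {n : ℕ}

theorem exists_continuousLinearMap_trace (n : ℕ) : ∃ τ : (En n →L[ℝ] En n) →L[ℝ] ℝ,
    ∀ T : En n →L[ℝ] En n, τ T = LinearMap.trace ℝ (En n) T :=
  ⟨LinearMap.toContinuousLinearMap
    ((LinearMap.trace ℝ (En n)).comp (ContinuousLinearMap.coeLM ℝ)), fun _ => rfl⟩

theorem integrable_inner_gradient {Φ : En n → En n} {ψ : En n → ℝ} {B : ℝ} {D : ℝ≥0}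
    (hΦ : AEStronglyMeasurable Φ volume) (hB : ∀ x, ‖Φ x‖ ≤ B) (hψ : LipschitzWith D ψ)
    (hψc : HasCompactSupport ψ) : Integrable (fun x => ⟪Φ x, gradient ψ x⟫) := by
  refine integrable_of_bound_on_compact hψc.isCompact
    (hΦ.inner (measurable_gradient ψ).aestronglyMeasurable) (C := B * D) (fun x _ => ?_)
    (fun x hx => by rw [gradient_eq_zero_of_notMem_tsupport hx, inner_zero_right])
  exact (norm_inner_le_norm _ _).trans (mul_le_mul (hB x) (norm_gradient_le_of_lipschitzWith hψ x)
    (norm_nonneg _) ((norm_nonneg _).trans (hB x)))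

/-- Passing to the limit `s → 0` in the integrated form of the regularized inequality. -/
theorem neg_mul_integral_le_of_regDiv_le {p : En n → ℝ} {G : En n → En n} {P D Dψ : ℝ≥0}
    {q₂ L C e : ℝ} (hp : Differentiable ℝ p) (hP : LipschitzWith P p)
    (hq : ∀ x, 1 ≤ p x ∧ p x ≤ q₂) (hG : LipschitzWith D G) (hGL : ∀ x, ‖G x‖ ≤ L)
    {ψ : En n → ℝ} (hψ : LipschitzWith Dψ ψ) (hψc : HasCompactSupport ψ) (hψ0 : ∀ x, 0 ≤ ψ x)
    (he : 0 ≤ e)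
    (hC : ∀ x ∈ tsupport ψ, ∀ X, HasFDerivAt G X x → ∀ s, 0 < s → s ≤ 1 →
      regDiv s (p x) X (G x) (gradient p x) ≤ C)
    (hlim : ∀ x ∈ tsupport ψ, ∀ X, HasFDerivAt G X x →
      Tendsto (fun s => max (regDiv s (p x) X (G x) (gradient p x)) e) (𝓝[>] 0) (𝓝 e)) :
    -e * ∫ x, ψ x ≤ ∫ x, ⟪regFlux 0 (p x) (G x), gradient ψ x⟫ := by
  obtain ⟨τ, hτ⟩ := exists_continuousLinearMap_trace n
  set s : ℕ → ℝ := fun k => 1 / ((k : ℝ) + 1) with hs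
  have hs0 : ∀ k, 0 < s k := fun k => by rw [hs]; positivity
  have hs1 : ∀ k, s k ≤ 1 := fun k => by
    simp only [hs]; rw [div_le_one (by positivity)]; linarith [(k.cast_nonneg : (0 : ℝ) ≤ k)]
  have hst : Tendsto s atTop (𝓝[>] 0) :=
    tendsto_nhdsWithin_iff.mpr ⟨tendsto_one_div_add_atTop_nhds_zero_nat,
      Eventually.of_forall hs0⟩
  set Φ : ℕ → En n → En n := fun k x => regFlux (s k) (p x) (G x) with hΦ
  have hpB : ∀ x, |p x| ≤ q₂ := fun x => by
    rw [abs_of_nonneg (by linarith [(hq x).1])]; exact (hq x).2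
  choose A hA using fun k => exists_lipschitzWith_regFlux (hs0 k) hP hG hpB hGL
  have hΦB : ∀ k x, ‖Φ k x‖ ≤ (1 + L ^ 2) ^ q₂ := fun k x =>
    norm_regFlux_le (hs0 k).le (hs1 k) (hq x).1 (hq x).2 (hGL x)
  have hψi : Integrable ψ := hψ.continuous.integrable_of_hasCompactSupport hψc
  -- the left-hand sides converge
  have hleft : Tendsto (fun k => ∫ x, ⟪Φ k x, gradient ψ x⟫) atTop
      (𝓝 (∫ x, ⟪regFlux 0 (p x) (G x), gradient ψ x⟫)) := by
    refine tendsto_integral_of_dominated_convergence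
      (fun x => (1 + L ^ 2) ^ q₂ * ‖gradient ψ x‖) (fun k => ?_) ?_ (fun k => ?_) ?_
    · exact (hA k).continuous.aestronglyMeasurable.inner
        (measurable_gradient ψ).aestronglyMeasurable
    · refine Integrable.const_mul (integrable_of_bound_on_compact hψc.isCompact
        (measurable_gradient ψ).norm.aestronglyMeasurable (C := Dψ) (fun x _ => ?_)
        (fun x hx => by rw [gradient_eq_zero_of_notMem_tsupport hx, norm_zero])) _
      rw [norm_norm]
      exact norm_gradient_le_of_lipschitzWith hψ x
    · refine Eventually.of_forall fun x => (norm_inner_le_norm _ _).trans ?_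
      gcongr
      exact hΦB k x
    · refine Eventually.of_forall fun x => ?_
      exact ((tendsto_regFlux (p x) (G x)).comp hst).inner tendsto_const_nhds
  -- the right-hand sides converge
  set m : ℕ → En n → ℝ := fun k x => max (τ (fderiv ℝ (Φ k) x)) e * ψ x with hm
  have htm : ∀ k, Measurable (fun x => τ (fderiv ℝ (Φ k) x)) := fun k =>
    τ.continuous.measurable.comp (measurable_fderiv ℝ _)
  have hmm : ∀ k, AEStronglyMeasurable (m k) volume := fun k =>
    (((htm k).max measurable_const).mul hψ.continuous.measurable).aestronglyMeasurable
  have hτdiv : ∀ x X, HasFDerivAt G X x → ∀ k,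
      τ (fderiv ℝ (Φ k) x) = regDiv (s k) (p x) X (G x) (gradient p x) := fun x X hX k => by
    rw [hτ]; exact trace_fderiv_regFlux (hs0 k) (hp x) hX
  have hmb : ∀ k, ∀ᵐ x, ‖m k x‖ ≤ max C e * ψ x := by
    intro k
    filter_upwards [hG.ae_differentiableAt] with x hx
    by_cases hxs : x ∈ tsupport ψ
    · rw [hm, Real.norm_eq_abs, abs_of_nonneg (mul_nonneg (he.trans (le_max_right _ _)) (hψ0 x))]
      have h1 := hC x hxs _ hx.hasFDerivAt (s k) (hs0 k) (hs1 k)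
      rw [hτdiv x _ hx.hasFDerivAt k]
      exact mul_le_mul_of_nonneg_right (max_le_max h1 le_rfl) (hψ0 x)
    · simp [hm, image_eq_zero_of_notMem_tsupport hxs]
  have hright : Tendsto (fun k => ∫ x, m k x) atTop (𝓝 (∫ x, e * ψ x)) := by
    refine tendsto_integral_of_dominated_convergence (fun x => max C e * ψ x) hmm
      (hψi.const_mul _) hmb ?_
    filter_upwards [hG.ae_differentiableAt] with x hx
    by_cases hxs : x ∈ tsupport ψ
    · have h1 := ((hlim x hxs _ hx.hasFDerivAt).comp hst).mul_const (ψ x)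
      refine h1.congr fun k => ?_
      simp only [hm, Function.comp_apply]
      rw [hτdiv x _ hx.hasFDerivAt k]
    · simp [hm, image_eq_zero_of_notMem_tsupport hxs]
  have hle : ∀ k, -∫ x, m k x ≤ ∫ x, ⟪Φ k x, gradient ψ x⟫ := by
    intro k
    rw [integral_inner_gradient_eq (hA k) hψ (Or.inl hψc), neg_le_neg_iff]
    simp_rw [← hτ]
    refine integral_mono_ae ?_ (Integrable.mono' (hψi.const_mul _) (hmm k) (hmb k)) ?_
    · obtain ⟨B, hB⟩ := hψc.isCompact.exists_bound_of_continuousOn hψ.continuous.continuousOn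
      refine integrable_of_bound_on_compact hψc.isCompact
        ((htm k).mul hψ.continuous.measurable).aestronglyMeasurable (C := ‖τ‖ * A k * B)
        (fun x hx => ?_) (fun x hx => ?_)
      · rw [norm_mul]
        refine mul_le_mul ?_ (hB x hx) (norm_nonneg _) (by positivity)
        exact (τ.le_opNorm _).trans
          (mul_le_mul_of_nonneg_left (norm_fderiv_le_of_lipschitz ℝ (hA k)) (norm_nonneg _))
      · simp [image_eq_zero_of_notMem_tsupport hx]
    · refine Eventually.of_forall fun x => ?_
      exact mul_le_mul_of_nonneg_right (le_max_left _ _) (hψ0 x)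
  have := le_of_tendsto_of_tendsto hright.neg hleft (Eventually.of_forall hle)
  rwa [integral_const_mul, ← neg_mul] at this

/-- Regularization of a Lipschitz viscosity supersolution by `C¹` functions which are almost weak
supersolutions. -/
theorem exists_weak_regularization {p u : En n → ℝ} {U K : Set (En n)}
    (hvisc : IsViscositySupersolution p u U) (hU : IsOpen U) (hK : IsCompact K) (hKU : K ⊆ U)
    {L P : ℝ≥0} (hu : LipschitzWith L u) (hp : Differentiable ℝ p) (hP : LipschitzWith P p)
    (hunif : UniformContinuous (gradient p)) {q₁ q₂ : ℝ} (hq₁ : 1 < q₁) (hq₁' : q₁ ≤ 2)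
    (hq : ∀ x, q₁ ≤ p x ∧ p x ≤ q₂) {ε : ℝ} (hε : 0 < ε) :
    ∃ (v : En n → ℝ) (G : En n → En n), LipschitzWith L v ∧ (∀ x, v x ≤ u x) ∧
      (∀ x, u x - ε ≤ v x) ∧ (∀ x, HasGradientAt v (G x) x) ∧ Continuous G ∧
      ∀ (ψ : En n → ℝ) (Dψ : ℝ≥0), LipschitzWith Dψ ψ → tsupport ψ ⊆ K → (∀ x, 0 ≤ ψ x) →
        -ε * ∫ x, ψ x ≤ ∫ x, ⟪regFlux 0 (p x) (G x), gradient ψ x⟫ := by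
  obtain ⟨A, hA0, hA⟩ := exists_pointwise_regularization hvisc hu hP hq₁ hq₁' hq
  obtain ⟨δ, hδ, hδU⟩ := hK.exists_cthickening_subset_open hU hKU
  set ω := ε / (2 * (A + 1)) with hω
  have hω0 : 0 < ω := by positivity
  obtain ⟨δ', hδ', hδω⟩ := Metric.uniformContinuous_iff.mp hunif ω hω0
  set R := min (min δ (δ' / 2)) (min 1 (ε / (2 * (L + A + 1)))) with hR
  have hR0 : 0 < R := by
    refine lt_min (lt_min hδ (by positivity)) (lt_min one_pos (by positivity))
  have hRδ : R ≤ δ := (min_le_left _ _).trans (min_le_left _ _)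
  have hRδ' : R < δ' := ((min_le_left _ _).trans (min_le_right _ _)).trans_lt (by linarith)
  have hR1 : R ≤ 1 := (min_le_right _ _).trans (min_le_left _ _)
  have hRε : R ≤ ε / (2 * (L + A + 1)) := (min_le_right _ _).trans (min_le_right _ _)
  rw [le_div_iff₀ (by positivity)] at hRε
  have hLR : (L : ℝ) * R ≤ ε / 2 := by nlinarith [L.2, mul_nonneg hA0 hR0.le]
  have hAR : A * (R + ω) ≤ ε := by
    have h1 : A * R ≤ ε / 2 := by nlinarith [mul_nonneg L.2 hR0.le]
    have h2 : ω * (2 * (A + 1)) = ε := by rw [hω]; field_simp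
    nlinarith
  obtain ⟨v, G, hvL, hvu, huv, hG, ⟨D, hD⟩, C, hC⟩ := hA R ω (ε / 2) hR0 hR1 (by positivity)
    fun x y hxy => by
      have := hδω (a := x) (b := y) (by rw [dist_eq_norm]; exact hxy.trans_lt hRδ')
      rw [dist_eq_norm] at this
      exact this.le
  refine ⟨v, G, hvL, hvu, fun x => by linarith [huv x], hG, hD.continuous,
    fun ψ Dψ hψ hψK hψ0 => ?_⟩
  have hψc : HasCompactSupport ψ := hK.of_isClosed_subset (isClosed_tsupport ψ) hψK
  have hmem : ∀ x ∈ tsupport ψ, ∀ y, ‖x - y‖ ≤ R → y ∈ U := fun x hx y hxy =>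
    hδU (mem_cthickening_of_dist_le y x δ K (hψK hx)
      (by rw [dist_comm, dist_eq_norm]; exact hxy.trans hRδ))
  have h1 := neg_mul_integral_le_of_regDiv_le (e := A * (R + ω)) (C := C) hp hP
    (fun x => ⟨by linarith [(hq x).1], (hq x).2⟩) hD
    (fun x => norm_le_of_hasGradientAt_of_lipschitzWith hvL (hG x)) hψ hψc hψ0 (by positivity)
    (fun x hx X hX => (hC x X hX (hmem x hx)).1) (fun x hx X hX => (hC x X hX (hmem x hx)).2)
  refine le_trans ?_ h1
  exact mul_le_mul_of_nonneg_right (by linarith) (integral_nonneg hψ0)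

end IntegralRegularization

section Monotonicity

variable {n : ℕ}

theorem rpow_sub_two_mul_self {a q : ℝ} (ha : 0 ≤ a) (hq : 1 < q) :
    a ^ (q - 2) * a = a ^ (q - 1) := by
  rcases ha.eq_or_lt with rfl | ha
  · simp [Real.zero_rpow (by linarith : q - 1 ≠ 0)]
  · rw [show q - 1 = q - 2 + 1 by ring, Real.rpow_add_one ha.ne']

theorem norm_regFlux_zero {q : ℝ} (hq : 1 < q) (ξ : En n) : ‖regFlux 0 q ξ‖ = ‖ξ‖ ^ (q - 1) := by
  rw [regFlux_zero, norm_smul, Real.norm_eq_abs,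
    abs_of_nonneg (Real.rpow_nonneg (norm_nonneg ξ) _), rpow_sub_two_mul_self (norm_nonneg ξ) hq]

theorem continuous_regFlux_zero {q : ℝ} (hq : 1 < q) : Continuous (regFlux (n := n) 0 q) := by
  rw [continuous_iff_continuousAt]
  intro ξ
  by_cases hξ : ξ = 0
  · subst hξ
    have h0 : regFlux 0 q (0 : En n) = 0 := by simp [regFlux]
    rw [ContinuousAt, h0, tendsto_zero_iff_norm_tendsto_zero]
    simp_rw [norm_regFlux_zero hq]
    have h1 : Tendsto (fun ξ : En n => ‖ξ‖ ^ (q - 1)) (𝓝 0) (𝓝 (‖(0 : En n)‖ ^ (q - 1))) :=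
      (continuous_norm.tendsto 0).rpow_const (Or.inr (by linarith))
    rwa [norm_zero, Real.zero_rpow (by linarith : q - 1 ≠ 0)] at h1
  · have h1 : regFlux (n := n) 0 q = fun ξ => ‖ξ‖ ^ (q - 2) • ξ := funext (regFlux_zero q)
    rw [h1]
    exact (continuous_norm.continuousAt.rpow_const (Or.inl (norm_ne_zero_iff.mpr hξ))).smul
      continuousAt_id

theorem inner_regFlux_zero_sub_ge {q : ℝ} (hq : 1 < q) (ξ η : En n) :
    (‖ξ‖ ^ (q - 1) - ‖η‖ ^ (q - 1)) * (‖ξ‖ - ‖η‖) ≤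
      ⟪regFlux 0 q ξ - regFlux 0 q η, ξ - η⟫ := by
  have ha := rpow_sub_two_mul_self (norm_nonneg ξ) hq
  have hb := rpow_sub_two_mul_self (norm_nonneg η) hq
  have h0 := mul_le_mul_of_nonneg_left (real_inner_le_norm ξ η)
    (add_nonneg (Real.rpow_nonneg (norm_nonneg ξ) (q - 2))
      (Real.rpow_nonneg (norm_nonneg η) (q - 2)))
  simp only [regFlux_zero, inner_sub_left, inner_sub_right, real_inner_smul_left,
    real_inner_self_eq_norm_sq, real_inner_comm ξ η]
  rw [← ha, ← hb]
  nlinarith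

theorem rpow_sub_one_sub_mul_nonneg {a b q : ℝ} (ha : 0 ≤ a) (hb : 0 ≤ b) (hq : 1 < q) :
    0 ≤ (a ^ (q - 1) - b ^ (q - 1)) * (a - b) := by
  rcases le_total a b with h | h
  · have := Real.rpow_le_rpow ha h (by linarith : 0 ≤ q - 1)
    exact mul_nonneg_of_nonpos_of_nonpos (by linarith) (by linarith)
  · have := Real.rpow_le_rpow hb h (by linarith : 0 ≤ q - 1)
    exact mul_nonneg (by linarith) (by linarith)

theorem inner_regFlux_zero_sub_nonneg {q : ℝ} (hq : 1 < q) (ξ η : En n) :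
    0 ≤ ⟪regFlux 0 q ξ - regFlux 0 q η, ξ - η⟫ :=
  (rpow_sub_one_sub_mul_nonneg (norm_nonneg _) (norm_nonneg _) hq).trans
    (inner_regFlux_zero_sub_ge hq ξ η)

theorem eq_of_inner_regFlux_zero_sub_eq_zero {q : ℝ} (hq : 1 < q) {ξ η : En n}
    (h : ⟪regFlux 0 q ξ - regFlux 0 q η, ξ - η⟫ = 0) : ξ = η := by
  have h1 : (‖ξ‖ ^ (q - 1) - ‖η‖ ^ (q - 1)) * (‖ξ‖ - ‖η‖) = 0 :=
    le_antisymm (h ▸ inner_regFlux_zero_sub_ge hq ξ η)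
      (rpow_sub_one_sub_mul_nonneg (norm_nonneg _) (norm_nonneg _) hq)
  have h2 : ‖ξ‖ = ‖η‖ := by
    rcases mul_eq_zero.mp h1 with h2 | h2
    · exact (Real.rpow_left_inj (norm_nonneg _) (norm_nonneg _) (by linarith)).mp
        (sub_eq_zero.mp h2)
    · exact sub_eq_zero.mp h2
  rw [regFlux_zero, regFlux_zero, h2, ← smul_sub, real_inner_smul_left,
    real_inner_self_eq_norm_sq] at h
  rcases mul_eq_zero.mp h with h3 | h3
  · have h4 : ‖η‖ = 0 := by
      by_contra h5
      exact (Real.rpow_pos_of_pos ((norm_nonneg η).lt_of_ne' h5) _).ne' h3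
    rw [norm_eq_zero.mp h4, norm_eq_zero.mp (h2.trans h4)]
  · exact sub_eq_zero.mp (norm_eq_zero.mp (pow_eq_zero_iff two_ne_zero |>.mp h3))

/-- Strict monotonicity of the flux improves convergence of the monotone gap to convergence. -/
theorem tendsto_of_tendsto_inner_regFlux_zero_sub {q L : ℝ} (hq : 1 < q) {ξ : ℕ → En n} {η : En n}
    (hL : ∀ k, ‖ξ k‖ ≤ L)
    (h : Tendsto (fun k => ⟪regFlux 0 q (ξ k) - regFlux 0 q η, ξ k - η⟫) atTop (𝓝 0)) :
    Tendsto ξ atTop (𝓝 η) := by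
  refine (isCompact_closedBall (0 : En n) L).tendsto_nhds_of_unique_mapClusterPt
    (Eventually.of_forall fun k => by simpa using hL k) fun y _ hy => ?_
  have hc : Continuous fun y => ⟪regFlux 0 q y - regFlux 0 q η, y - η⟫ :=
    ((continuous_regFlux_zero hq).sub continuous_const).inner (continuous_id.sub continuous_const)
  have h1 := hy.continuousAt_comp hc.continuousAt
  exact eq_of_inner_regFlux_zero_sub_eq_zero hq (eq_of_nhds_neBot (ClusterPt.mono h1 h))

end Monotonicity

section WeakConvergence

variable {n : ℕ}

theorem exists_seq_tendsto_ae_of_tendsto_integral {α : Type*} [MeasurableSpace α] {μ : Measure α}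
    {f : ℕ → α → ℝ} (hf : ∀ k, Integrable (f k) μ) (h0 : ∀ k x, 0 ≤ f k x)
    (h : Tendsto (fun k => ∫ x, f k x ∂μ) atTop (𝓝 0)) :
    ∃ ns : ℕ → ℕ, StrictMono ns ∧ ∀ᵐ x ∂μ, Tendsto (fun i => f (ns i) x) atTop (𝓝 0) := by
  refine TendstoInMeasure.exists_seq_tendsto_ae (g := fun _ => 0)
    (tendstoInMeasure_of_tendsto_eLpNorm one_ne_zero (fun k => (hf k).1)
      aestronglyMeasurable_const ?_)
  have h1 := ENNReal.tendsto_ofReal h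
  rw [ENNReal.ofReal_zero] at h1
  refine h1.congr fun k => ?_
  have h2 : f k - (fun _ => (0 : ℝ)) = f k := by ext x; simp
  rw [h2, eLpNorm_one_eq_lintegral_enorm, ← ofReal_integral_norm_eq_lintegral_enorm (hf k)]
  simp_rw [Real.norm_eq_abs, abs_of_nonneg (h0 k _)]

/-- Gradients of equi-Lipschitz functions converging uniformly to zero converge weakly to zero. -/
theorem tendsto_integral_inner_gradient {Φ : En n → En n} (hΦ : Integrable Φ)
    {w : ℕ → En n → ℝ} {D : ℝ≥0} {e : ℕ → ℝ} (hw : ∀ k, LipschitzWith D (w k))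
    (hwe : ∀ k x, |w k x| ≤ e k) (he : Tendsto e atTop (𝓝 0)) :
    Tendsto (fun k => ∫ x, ⟪Φ x, gradient (w k) x⟫) atTop (𝓝 0) := by
  obtain ⟨τ, hτ⟩ := exists_continuousLinearMap_trace n
  rw [Metric.tendsto_atTop]
  intro ε hε
  obtain ⟨g, hgc, hg, hgε⟩ := (memLp_one_iff_integrable.mpr hΦ).exist_eLpNorm_sub_le
    ENNReal.one_ne_top le_rfl (by positivity : 0 < ε / (2 * (D + 1)))
  have hgi : Integrable g := hg.continuous.integrable_of_hasCompactSupport hgc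
  have hdiff : ∫ x, ‖Φ x - g x‖ ≤ ε / (2 * (D + 1)) := by
    rw [eLpNorm_one_eq_lintegral_enorm, ← ofReal_integral_norm_eq_lintegral_enorm (hΦ.sub hgi)]
      at hgε
    exact (ENNReal.ofReal_le_ofReal_iff (by positivity)).mp hgε
  obtain ⟨C, hC⟩ := (hg.of_le (by simp) : ContDiff ℝ 1 g).lipschitzWith_of_hasCompactSupport hgc
    one_ne_zero
  have hcont : Continuous fun x => τ (fderiv ℝ g x) :=
    τ.continuous.comp (hg.continuous_fderiv (by simp))
  have hti : Integrable fun x => τ (fderiv ℝ g x) := by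
    refine hcont.integrable_of_hasCompactSupport ?_
    exact (hgc.fderiv ℝ).comp_left (map_zero τ)
  set T := ∫ x, ‖τ (fderiv ℝ g x)‖ with hT
  have hinn : ∀ (Ψ : En n → En n), Integrable Ψ → ∀ k,
      Integrable fun x => ⟪Ψ x, gradient (w k) x⟫ := fun Ψ hΨ k => by
    refine Integrable.mono' (hΨ.norm.mul_const (D : ℝ))
      (hΨ.1.inner (measurable_gradient _).aestronglyMeasurable) (Eventually.of_forall fun x => ?_)
    exact (norm_inner_le_norm _ _).trans
      (mul_le_mul_of_nonneg_left (norm_gradient_le_of_lipschitzWith (hw k) x) (norm_nonneg _))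
  have hbound : ∀ k, |∫ x, ⟪Φ x, gradient (w k) x⟫| ≤ ε / 2 + T * e k := by
    intro k
    have h1 : ∫ x, ⟪Φ x, gradient (w k) x⟫ =
        (∫ x, ⟪Φ x - g x, gradient (w k) x⟫) + -∫ x, τ (fderiv ℝ g x) * w k x := by
      simp_rw [hτ]
      rw [← integral_inner_gradient_eq hC (hw k) (Or.inr hgc),
        ← integral_add (hinn (fun x => Φ x - g x) (hΦ.sub hgi) k) (hinn _ hgi k)]
      simp_rw [← inner_add_left, sub_add_cancel]
    have h2 : |∫ x, ⟪Φ x - g x, gradient (w k) x⟫| ≤ ε / 2 := by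
      calc |∫ x, ⟪Φ x - g x, gradient (w k) x⟫| ≤ ∫ x, ‖Φ x - g x‖ * D := by
            rw [← Real.norm_eq_abs]
            refine norm_integral_le_of_norm_le ((hΦ.sub hgi).norm.mul_const _)
              (Eventually.of_forall fun x => ?_)
            exact (norm_inner_le_norm _ _).trans
              (mul_le_mul_of_nonneg_left (norm_gradient_le_of_lipschitzWith (hw k) x)
                (norm_nonneg _))
        _ = (∫ x, ‖Φ x - g x‖) * D := integral_mul_const _ _
        _ ≤ ε / (2 * (D + 1)) * D := mul_le_mul_of_nonneg_right hdiff D.2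
        _ ≤ ε / (2 * (D + 1)) * (D + 1) := by
            refine mul_le_mul_of_nonneg_left (by linarith) (by positivity)
        _ = ε / 2 := by field_simp
    have h3 : |∫ x, τ (fderiv ℝ g x) * w k x| ≤ T * e k := by
      rw [hT, ← integral_mul_const, ← Real.norm_eq_abs]
      refine norm_integral_le_of_norm_le (hti.norm.mul_const _) (Eventually.of_forall fun x => ?_)
      rw [norm_mul]
      exact mul_le_mul_of_nonneg_left (hwe k x) (norm_nonneg _)
    rw [h1]
    refine (abs_add_le _ _).trans ?_
    rw [abs_neg]
    exact add_le_add h2 h3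
  have hTe : Tendsto (fun k => T * e k) atTop (𝓝 0) := by simpa using he.const_mul T
  obtain ⟨N, hN⟩ := eventually_atTop.mp (hTe.eventually_lt_const (half_pos hε))
  refine ⟨N, fun k hk => ?_⟩
  rw [Real.dist_eq, sub_zero]
  linarith [hbound k, hN k hk]

end WeakConvergence

section MonotonicityMethod

variable {n : ℕ}

theorem measurable_regFlux_zero {p : En n → ℝ} {G : En n → En n} (hp : Measurable p)
    (hG : Measurable G) : Measurable fun x => regFlux 0 (p x) (G x) := by
  simp_rw [regFlux_zero]
  exact (hG.norm.pow (hp.sub_const 2)).smul hG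

theorem exists_lipschitzWith_mul {η w : En n → ℝ} {A B : ℝ} {C D : ℝ≥0} (hη : LipschitzWith C η)
    (hw : LipschitzWith D w) (hA : ∀ x, |η x| ≤ A) (hB : ∀ x, |w x| ≤ B) :
    ∃ E, LipschitzWith E fun x => η x * w x := by
  refine ⟨A.toNNReal * D + B.toNNReal * C, LipschitzWith.of_dist_le_mul fun x y => ?_⟩
  have h1 := hη.dist_le_mul x y
  have h2 := hw.dist_le_mul x y
  have hA0 : 0 ≤ A := (abs_nonneg _).trans (hA x)
  have hB0 : 0 ≤ B := (abs_nonneg _).trans (hB x)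
  rw [Real.dist_eq] at h1 h2
  rw [Real.dist_eq, show η x * w x - η y * w y = η x * (w x - w y) + w y * (η x - η y) by ring]
  refine (abs_add_le _ _).trans ?_
  rw [abs_mul, abs_mul]
  push_cast
  rw [Real.coe_toNNReal A hA0, Real.coe_toNNReal B hB0, add_mul, mul_assoc, mul_assoc]
  exact add_le_add (mul_le_mul (hA x) h2 (abs_nonneg _) hA0)
    (mul_le_mul (hB y) h1 (abs_nonneg _) hB0)

theorem gradient_sub_eq {f g : En n → ℝ} {x : En n} (hf : DifferentiableAt ℝ f x)
    (hg : DifferentiableAt ℝ g x) :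
    gradient (fun x => f x - g x) x = gradient f x - gradient g x := by
  rw [gradient, fderiv_fun_sub hf hg, map_sub]
  rfl

theorem gradient_mul_eq {f g : En n → ℝ} {x : En n} (hf : DifferentiableAt ℝ f x)
    (hg : DifferentiableAt ℝ g x) :
    gradient (fun x => f x * g x) x = f x • gradient g x + g x • gradient f x := by
  rw [gradient, fderiv_fun_mul hf hg, map_add]
  simp only [map_smulₛₗ, conj_trivial]
  rfl

/-- Testing almost weak supersolutions `v k` with `η (u - v k)` shows that the monotone gap
between the fluxes of `v k` and `u` vanishes in the limit. -/
theorem tendsto_integral_monotone_gap {p u η : En n → ℝ} {v : ℕ → En n → ℝ}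
    {G : ℕ → En n → En n} {e : ℕ → ℝ} {K : Set (En n)} {L C : ℝ≥0} {q₂ : ℝ} (hp : Continuous p)
    (hq : ∀ x, 1 < p x ∧ p x ≤ q₂) (hu : LipschitzWith L u) (hv : ∀ k, LipschitzWith L (v k))
    (hvu : ∀ k x, v k x ≤ u x) (huv : ∀ k x, u x - e k ≤ v k x)
    (hG : ∀ k x, HasGradientAt (v k) (G k x) x) (hGc : ∀ k, Continuous (G k))
    (he0 : ∀ k, 0 ≤ e k) (he : Tendsto e atTop (𝓝 0))
    (hweak : ∀ k (ψ : En n → ℝ) (Dψ : ℝ≥0), LipschitzWith Dψ ψ → tsupport ψ ⊆ K →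
      (∀ x, 0 ≤ ψ x) → -e k * ∫ x, ψ x ≤ ∫ x, ⟪regFlux 0 (p x) (G k x), gradient ψ x⟫)
    (hη : LipschitzWith C η) (hηc : HasCompactSupport η) (hηK : tsupport η ⊆ K)
    (hη0 : ∀ x, 0 ≤ η x) (hη1 : ∀ x, η x ≤ 1) :
    (∀ k, Integrable fun x => η x *
      ⟪regFlux 0 (p x) (G k x) - regFlux 0 (p x) (gradient u x), G k x - gradient u x⟫) ∧
    Tendsto (fun k => ∫ x, η x *
      ⟪regFlux 0 (p x) (G k x) - regFlux 0 (p x) (gradient u x), G k x - gradient u x⟫)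
      atTop (𝓝 0) := by
  set M : ℝ := (1 + (L : ℝ) ^ 2) ^ q₂ with hM
  have hM0 : 0 ≤ M := by positivity
  set F : ℕ → En n → En n := fun k x => regFlux 0 (p x) (G k x) with hF
  set Fu : En n → En n := fun x => regFlux 0 (p x) (gradient u x) with hFu
  have hFm : ∀ k, Measurable (F k) := fun k =>
    measurable_regFlux_zero hp.measurable (hGc k).measurable
  have hFum : Measurable Fu := measurable_regFlux_zero hp.measurable (measurable_gradient u)
  have hFM : ∀ k x, ‖F k x‖ ≤ M := fun k x => norm_regFlux_le le_rfl zero_le_one (hq x).1.le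
    (hq x).2 (norm_le_of_hasGradientAt_of_lipschitzWith (hv k) (hG k x))
  have hFuM : ∀ x, ‖Fu x‖ ≤ M := fun x => norm_regFlux_le le_rfl zero_le_one (hq x).1.le
    (hq x).2 (norm_gradient_le_of_lipschitzWith hu x)
  set w : ℕ → En n → ℝ := fun k x => u x - v k x with hw
  have hw0 : ∀ k x, 0 ≤ w k x := fun k x => sub_nonneg.mpr (hvu k x)
  have hwe : ∀ k x, w k x ≤ e k := fun k x => by simp only [hw]; linarith [huv k x]
  have hwabs : ∀ k x, |w k x| ≤ e k := fun k x => by rw [abs_of_nonneg (hw0 k x)]; exact hwe k x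
  have hwL : ∀ k, LipschitzWith (L + L) (w k) := fun k => hu.sub (hv k)
  have hηabs : ∀ x, |η x| ≤ 1 := fun x => by rw [abs_of_nonneg (hη0 x)]; exact hη1 x
  choose E hE using fun k => exists_lipschitzWith_mul hη (hwL k) hηabs (hwabs k)
  have hsub : ∀ k, tsupport (fun x => η x * w k x) ⊆ tsupport η := fun k =>
    closure_mono (Function.support_mul_subset_left η (w k))
  have hηi : Integrable η := hη.continuous.integrable_of_hasCompactSupport hηc
  have hdηi : Integrable fun x => ‖gradient η x‖ := by
    refine integrable_of_bound_on_compact hηc.isCompact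
      (measurable_gradient η).norm.aestronglyMeasurable (C := C) (fun x _ => ?_)
      (fun x hx => by rw [gradient_eq_zero_of_notMem_tsupport hx, norm_zero])
    rw [norm_norm]
    exact norm_gradient_le_of_lipschitzWith hη x
  -- decomposition of the gap
  have hI1b : ∀ k x, ‖w k x * ⟪F k x, gradient η x⟫‖ ≤ e k * (M * ‖gradient η x‖) := by
    intro k x
    rw [norm_mul]
    refine mul_le_mul (hwabs k x) ((norm_inner_le_norm _ _).trans ?_) (norm_nonneg _) (he0 k)
    exact mul_le_mul_of_nonneg_right (hFM k x) (norm_nonneg _)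
  have hI1 : ∀ k, Integrable fun x => w k x * ⟪F k x, gradient η x⟫ := fun k =>
    Integrable.mono' ((hdηi.const_mul M).const_mul (e k))
      ((hwL k).continuous.aestronglyMeasurable.mul
        ((hFm k).aestronglyMeasurable.inner (measurable_gradient η).aestronglyMeasurable))
      (Eventually.of_forall (hI1b k))
  have hI2 : ∀ k, Integrable fun x => ⟪F k x, gradient (fun x => η x * w k x) x⟫ := fun k =>
    integrable_inner_gradient (hFm k).aestronglyMeasurable (hFM k) (hE k)
      (hηc.isCompact.of_isClosed_subset (isClosed_tsupport _) (hsub k))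
  have hηFu : Integrable fun x => η x • Fu x := by
    refine Integrable.mono' (hηi.mul_const M)
      (hη.continuous.aestronglyMeasurable.smul hFum.aestronglyMeasurable)
      (Eventually.of_forall fun x => ?_)
    rw [norm_smul, Real.norm_eq_abs, abs_of_nonneg (hη0 x)]
    exact mul_le_mul_of_nonneg_left (hFuM x) (hη0 x)
  have hI3 : ∀ k, Integrable fun x => ⟪η x • Fu x, gradient (w k) x⟫ := fun k => by
    refine Integrable.mono' (hηFu.norm.mul_const ((L + L : ℝ≥0) : ℝ))
      (hηFu.1.inner (measurable_gradient _).aestronglyMeasurable) (Eventually.of_forall fun x => ?_)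
    exact (norm_inner_le_norm _ _).trans
      (mul_le_mul_of_nonneg_left (norm_gradient_le_of_lipschitzWith (hwL k) x) (norm_nonneg _))
  have hdec : ∀ k, ∀ᵐ x, w k x * ⟪F k x, gradient η x⟫ -
      ⟪F k x, gradient (fun x => η x * w k x) x⟫ + ⟪η x • Fu x, gradient (w k) x⟫ =
      η x * ⟪F k x - Fu x, G k x - gradient u x⟫ := by
    intro k
    filter_upwards [hu.ae_differentiableAt, hη.ae_differentiableAt,
      (hwL k).ae_differentiableAt] with x hux hηx hwx
    have h1 : gradient (w k) x = gradient u x - G k x := by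
      rw [← (hG k x).gradient]
      exact gradient_sub_eq hux (hG k x).hasFDerivAt.differentiableAt
    rw [gradient_mul_eq hηx hwx, h1]
    simp only [inner_add_right, inner_sub_right, inner_sub_left, real_inner_smul_left,
      real_inner_smul_right]
    ring
  have hgap : ∀ k, Integrable fun x => η x * ⟪F k x - Fu x, G k x - gradient u x⟫ := fun k =>
    (((hI1 k).sub (hI2 k)).add (hI3 k)).congr (hdec k)
  refine ⟨hgap, ?_⟩
  have hbound : ∀ k, ∫ x, η x * ⟪F k x - Fu x, G k x - gradient u x⟫ ≤
      e k * (M * ∫ x, ‖gradient η x‖) + e k * (e k * ∫ x, η x) +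
        ∫ x, ⟪η x • Fu x, gradient (w k) x⟫ := by
    intro k
    have hI12 : Integrable fun x => w k x * ⟪F k x, gradient η x⟫ -
        ⟪F k x, gradient (fun x => η x * w k x) x⟫ := (hI1 k).sub (hI2 k)
    rw [← integral_congr_ae (hdec k), integral_add hI12 (hI3 k),
      integral_sub (hI1 k) (hI2 k)]
    have h1 : ∫ x, w k x * ⟪F k x, gradient η x⟫ ≤ e k * (M * ∫ x, ‖gradient η x‖) := by
      rw [← integral_const_mul, ← integral_const_mul]
      exact integral_mono (hI1 k) ((hdηi.const_mul M).const_mul (e k)) fun x =>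
        (le_abs_self _).trans (hI1b k x)
    have h2 := hweak k _ (E k) (hE k) ((hsub k).trans hηK)
      fun x => mul_nonneg (hη0 x) (hw0 k x)
    have h3 : ∫ x, η x * w k x ≤ e k * ∫ x, η x := by
      rw [← integral_const_mul]
      refine integral_mono_of_nonneg (Eventually.of_forall fun x => mul_nonneg (hη0 x) (hw0 k x))
        (hηi.const_mul _) (Eventually.of_forall fun x => ?_)
      simp only
      rw [mul_comm (e k)]
      exact mul_le_mul_of_nonneg_left (hwe k x) (hη0 x)
    have h4 := mul_le_mul_of_nonneg_left h3 (he0 k)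
    linarith
  have hlim : Tendsto (fun k => e k * (M * ∫ x, ‖gradient η x‖) + e k * (e k * ∫ x, η x) +
      ∫ x, ⟪η x • Fu x, gradient (w k) x⟫) atTop (𝓝 0) := by
    have h1 := he.mul_const (M * ∫ x, ‖gradient η x‖)
    have h2 := he.mul (he.mul_const (∫ x, η x))
    simpa using (h1.add h2).add (tendsto_integral_inner_gradient hηFu hwL hwabs he)
  exact squeeze_zero (fun k => integral_nonneg fun x => mul_nonneg (hη0 x)
    (inner_regFlux_zero_sub_nonneg (hq x).1 _ _)) hbound hlim

theorem exists_contDiff_cutoff {s K : Set (En n)} (hs : IsCompact s) (hK : IsCompact K)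
    (hsK : s ⊆ interior K) : ∃ η : En n → ℝ, ContDiff ℝ 1 η ∧ tsupport η ⊆ K ∧
      (∀ᶠ x in 𝓝ˢ s, η x = 1) ∧ ∀ x, 0 ≤ η x ∧ η x ≤ 1 := by
  obtain ⟨f, h1, h0, hf⟩ := exists_contMDiffMap_one_nhds_of_subset_interior (n := 1)
    (modelWithCornersSelf ℝ (En n)) hs.isClosed hsK
  refine ⟨f, f.contMDiff.contDiff, ?_, h1, hf⟩
  exact closure_minimal (fun x hx => by_contra fun h => hx (h0 x h)) hK.isClosed

/-- Lipschitz viscosity supersolutions are weak supersolutions, for globally defined data. -/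
theorem integral_inner_regFlux_gradient_nonneg {p u : En n → ℝ} {U : Set (En n)}
    (hvisc : IsViscositySupersolution p u U) (hU : IsOpen U) {L P : ℝ≥0} (hu : LipschitzWith L u)
    (hp : Differentiable ℝ p) (hP : LipschitzWith P p) (hunif : UniformContinuous (gradient p))
    {q₁ q₂ : ℝ} (hq₁ : 1 < q₁) (hq₁' : q₁ ≤ 2) (hq : ∀ x, q₁ ≤ p x ∧ p x ≤ q₂)
    {ψ : En n → ℝ} {D : ℝ≥0} (hψ : LipschitzWith D ψ) (hψc : HasCompactSupport ψ)
    (hψU : tsupport ψ ⊆ U) (hψ0 : ∀ x, 0 ≤ ψ x) :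
    0 ≤ ∫ x, ⟪regFlux 0 (p x) (gradient u x), gradient ψ x⟫ := by
  obtain ⟨K, hK, hψK, hKU⟩ := exists_compact_between hψc.isCompact hU hψU
  obtain ⟨η, hη, hηK, hη1, hη01⟩ := exists_contDiff_cutoff hψc.isCompact hK hψK
  have hηc : HasCompactSupport η := hK.of_isClosed_subset (isClosed_tsupport η) hηK
  obtain ⟨C, hC⟩ := hη.lipschitzWith_of_hasCompactSupport hηc one_ne_zero
  set e : ℕ → ℝ := fun k => 1 / ((k : ℝ) + 1) with he
  have he0 : ∀ k, 0 < e k := fun k => by rw [he]; positivity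
  have het : Tendsto e atTop (𝓝 0) := tendsto_one_div_add_atTop_nhds_zero_nat
  have hp1 : ∀ x, 1 < p x := fun x => hq₁.trans_le (hq x).1
  choose v G hv hvu huv hG hGc hweak using fun k =>
    exists_weak_regularization hvisc hU hK hKU hu hp hP hunif hq₁ hq₁' hq (he0 k)
  obtain ⟨hgi, hgt⟩ := tendsto_integral_monotone_gap hp.continuous
    (fun x => ⟨hp1 x, (hq x).2⟩) hu hv hvu huv hG hGc (fun k => (he0 k).le) het hweak hC hηc hηK
    (fun x => (hη01 x).1) (fun x => (hη01 x).2)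
  obtain ⟨ns, hns, hae⟩ := exists_seq_tendsto_ae_of_tendsto_integral hgi
    (fun k x => mul_nonneg (hη01 x).1 (inner_regFlux_zero_sub_nonneg (hp1 x) _ _)) hgt
  have hGL : ∀ k x, ‖G k x‖ ≤ L := fun k x =>
    norm_le_of_hasGradientAt_of_lipschitzWith (hv k) (hG k x)
  have hlim : Tendsto (fun i => ∫ x, ⟪regFlux 0 (p x) (G (ns i) x), gradient ψ x⟫) atTop
      (𝓝 (∫ x, ⟪regFlux 0 (p x) (gradient u x), gradient ψ x⟫)) := by
    refine tendsto_integral_of_dominated_convergence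
      (fun x => (1 + (L : ℝ) ^ 2) ^ q₂ * ‖gradient ψ x‖) (fun i => ?_) ?_ (fun i => ?_) ?_
    · exact (measurable_regFlux_zero hp.continuous.measurable
        (hGc _).measurable).aestronglyMeasurable.inner (measurable_gradient ψ).aestronglyMeasurable
    · refine Integrable.const_mul (integrable_of_bound_on_compact hψc.isCompact
        (measurable_gradient ψ).norm.aestronglyMeasurable (C := D) (fun x _ => ?_)
        (fun x hx => by rw [gradient_eq_zero_of_notMem_tsupport hx, norm_zero])) _
      rw [norm_norm]
      exact norm_gradient_le_of_lipschitzWith hψ x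
    · refine Eventually.of_forall fun x => (norm_inner_le_norm _ _).trans ?_
      exact mul_le_mul_of_nonneg_right (norm_regFlux_le le_rfl zero_le_one (hp1 x).le (hq x).2
        (hGL _ x)) (norm_nonneg _)
    · filter_upwards [hae] with x hx
      by_cases hxs : x ∈ tsupport ψ
      · rw [hη1.self_of_nhdsSet x hxs] at hx
        simp only [one_mul] at hx
        have h1 := tendsto_of_tendsto_inner_regFlux_zero_sub (hp1 x) (fun i => hGL (ns i) x) hx
        exact (((continuous_regFlux_zero (hp1 x)).tendsto _).comp h1).inner tendsto_const_nhds
      · simp [gradient_eq_zero_of_notMem_tsupport hxs]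
  have hleft : Tendsto (fun i => -e (ns i) * ∫ x, ψ x) atTop (𝓝 0) := by
    simpa using ((het.comp hns.tendsto_atTop).neg).mul_const (∫ x, ψ x)
  refine le_of_tendsto_of_tendsto hleft hlim (Eventually.of_forall fun i => ?_)
  exact hweak (ns i) ψ D hψ (hψK.trans interior_subset) hψ0

end MonotonicityMethod

section Localization

variable {n : ℕ}

theorem negPLap_congr {p p' φ : En n → ℝ} {x : En n} (h : p =ᶠ[𝓝 x] p') :
    negPLap p φ x = negPLap p' φ x := by
  simp only [negPLap, h.eq_of_nhds, h.gradient_eq]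

theorem IsViscositySupersolution.congr {p p' u u' : En n → ℝ} {D U : Set (En n)}
    (h : IsViscositySupersolution p u D) (hUD : U ⊆ D) (hU : IsOpen U) (hp : EqOn p p' U)
    (hu : EqOn u u' U) : IsViscositySupersolution p' u' U := by
  intro x hx φ hφ hφx hlt hne
  rw [← negPLap_congr (hp.eventuallyEq_of_mem (hU.mem_nhds hx))]
  refine h x (hUD hx) φ hφ (hφx.trans (hu hx).symm) ?_ hne
  filter_upwards [hlt, mem_nhdsWithin_of_mem_nhds (hU.mem_nhds hx)] with y hy hyU
  rwa [hu hyU]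

/-- A `C¹` exponent agrees near a compact set with a globally defined one, equal to `2` far away. -/
theorem exists_global_exponent {p : En n → ℝ} {Ω K : Set (En n)} (hΩ : IsOpen Ω)
    (hp : ContDiffOn ℝ 1 p Ω) (hK : IsCompact K) (hKΩ : K ⊆ Ω) {q₁ q₂ : ℝ} (hq₁ : q₁ ≤ 2)
    (hq₂ : 2 ≤ q₂) (hq : ∀ x ∈ Ω, q₁ ≤ p x ∧ p x ≤ q₂) :
    ∃ p' : En n → ℝ, EqOn p p' K ∧ Differentiable ℝ p' ∧ (∃ P, LipschitzWith P p') ∧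
      UniformContinuous (gradient p') ∧ ∀ x, q₁ ≤ p' x ∧ p' x ≤ q₂ := by
  obtain ⟨K', hK', hKK', hK'Ω⟩ := exists_compact_between hK hΩ hKΩ
  obtain ⟨χ, hχ, hχK', hχ1, hχ01⟩ := exists_contDiff_cutoff hK hK' hKK'
  set r : En n → ℝ := fun x => χ x * (p x - 2) with hr
  have hrs : tsupport r ⊆ K' :=
    (closure_mono (Function.support_mul_subset_left χ fun x => p x - 2)).trans hχK'
  have hrc : HasCompactSupport r := hK'.of_isClosed_subset (isClosed_tsupport r) hrs
  have hrd : ContDiff ℝ 1 r := by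
    rw [contDiff_iff_contDiffAt]
    intro x
    by_cases hx : x ∈ tsupport r
    · exact hχ.contDiffAt.mul
        ((hp.contDiffAt (hΩ.mem_nhds (hK'Ω (hrs hx)))).sub contDiffAt_const)
    · exact contDiffAt_const.congr_of_eventuallyEq (notMem_tsupport_iff_eventuallyEq.mp hx)
  obtain ⟨P, hP⟩ := hrd.lipschitzWith_of_hasCompactSupport hrc one_ne_zero
  have hgrad : gradient (fun x => 2 + r x) = gradient r := by
    ext1 x
    rw [gradient, gradient, fderiv_const_add]
  refine ⟨fun x => 2 + r x, fun x hx => ?_, fun x => ?_, ⟨P, ?_⟩, ?_, fun x => ?_⟩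
  · simp only [hr]
    rw [hχ1.self_of_nhdsSet x hx]
    ring
  · exact ((hrd.differentiable one_ne_zero) x).const_add 2
  · exact LipschitzWith.of_dist_le_mul fun x y => by
      rw [dist_add_left]; exact hP.dist_le_mul x y
  · rw [hgrad]
    refine Continuous.uniformContinuous_of_tendsto_cocompact (x := 0)
      ((InnerProductSpace.toDual ℝ (En n)).symm.continuous.comp
        (hrd.continuous_fderiv one_ne_zero)) ?_
    exact ((hrc.fderiv ℝ).comp_left
      (map_zero (InnerProductSpace.toDual ℝ (En n)).symm)).is_zero_at_infty
  · by_cases hx : x ∈ Ω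
    · have h1 := hq x hx
      have h2 := hχ01 x
      simp only [hr]
      constructor <;> nlinarith
    · have : r x = 0 := by
        rw [hr]
        simp only [image_eq_zero_of_notMem_tsupport fun h => hx (hK'Ω (hχK' h)), zero_mul]
      simp only [this, add_zero]
      exact ⟨hq₁, hq₂⟩

theorem weakIntegrand_eq (p u ψ : En n → ℝ) (x : En n) :
    weakIntegrand p u ψ x = ⟪regFlux 0 (p x) (gradient u x), gradient ψ x⟫ := by
  rw [weakIntegrand, regFlux_zero, real_inner_smul_left]
  split_ifs with h
  · rw [h, inner_zero_left, mul_zero]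
  · rfl

end Localization

/-- viscosity supersolutions satisfy the weak supersolution inequality. -/
theorem stmt2
    {n : ℕ} (hn : 1 ≤ n)
    (Ω : Set (En n)) (hΩo : IsOpen Ω) (hΩb : Bornology.IsBounded Ω)
    (p : En n → ℝ) (hp : ContDiffOn ℝ 1 p Ω)
    (pminus pplus : ℝ) (hpm : 1 < pminus)
    (hprange : ∀ x ∈ Ω, pminus ≤ p x ∧ p x ≤ pplus)
    (hcase : 2 ≤ pminus ∨ pplus < 2)
    (u : En n → ℝ)
    (hbddA : BddAbove (u '' Ω)) (hbddB : BddBelow (u '' Ω))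
    (hlip : LocLipschitzOn u Ω)
    (hvisc : IsViscositySupersolution p u Ω) :
    ∀ ψ : En n → ℝ, ContDiff ℝ (⊤ : ℕ∞) ψ → HasCompactSupport ψ →
      tsupport ψ ⊆ Ω → (∀ x, 0 ≤ ψ x) →
      0 ≤ ∫ x in Ω, weakIntegrand p u ψ x := by
  intro ψ hψ hψc hψΩ hψ0
  obtain ⟨K, hK, hψK, hKΩ⟩ := exists_compact_between hψc.isCompact hΩo hψΩ
  obtain ⟨p', hpp', hp'd, ⟨P, hP⟩, hunif, hq⟩ := exists_global_exponent hΩo hp hK hKΩ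
    (min_le_right pminus 2) (le_max_right pplus 2) fun x hx =>
      ⟨(min_le_left _ _).trans (hprange x hx).1, (hprange x hx).2.trans (le_max_left _ _)⟩
  obtain ⟨L, hL⟩ := LocallyLipschitzOn.exists_lipschitzOnWith_of_compact hK
    (LocallyLipschitzOn.mono (fun x hx => hlip x hx) hKΩ)
  obtain ⟨u', hu', huu'⟩ := hL.extend_real
  obtain ⟨D, hD⟩ := (hψ.of_le (by simp) : ContDiff ℝ 1 ψ).lipschitzWith_of_hasCompactSupport hψc
    one_ne_zero
  have h := integral_inner_regFlux_gradient_nonneg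
    (hvisc.congr (interior_subset.trans hKΩ) isOpen_interior (hpp'.mono interior_subset)
      (huu'.mono interior_subset))
    isOpen_interior hu' hp'd hP hunif (lt_min hpm one_lt_two) (min_le_right _ _) hq hD hψc hψK hψ0
  have hzero : ∀ x, x ∉ Ω → weakIntegrand p u ψ x = 0 := fun x hx => by
    rw [weakIntegrand_eq, gradient_eq_zero_of_notMem_tsupport fun h => hx (hψΩ h),
      inner_zero_right]
  rw [setIntegral_eq_integral_of_forall_compl_eq_zero hzero]
  refine h.trans_eq (integral_congr_ae (Eventually.of_forall fun x => ?_))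
  simp only [weakIntegrand_eq]
  by_cases hx : x ∈ tsupport ψ
  · have hxK : interior K ∈ 𝓝 x := isOpen_interior.mem_nhds (hψK hx)
    rw [hpp' (interior_subset (hψK hx)),
      ((huu'.mono interior_subset).eventuallyEq_of_mem hxK).gradient_eq]
  · simp only [gradient_eq_zero_of_notMem_tsupport hx, inner_zero_right]
end
end

section
/- Let Ω ⊂ ℝⁿ be a bounded open set, u : Ω → ℝ bounded and lower semicontinuous, q ≥ 2 and ε > 0. Then the function x ↦ sup_{y ∈ Y_ε(x)} |y − x| is upper semicontinuous on Ω_{r(ε)}, and for each x ∈ Ω_{r(ε)} the supremum is attained at some y ∈ Y_ε(x). -/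
open MeasureTheory Metric Set Filter Asymptotics
open scoped RealInnerProductSpace NNReal Topology

noncomputable section

theorem ball_infDist_frontier_subset {n : ℕ} {Ω : Set (En n)} {x : En n} (hx : x ∈ Ω) :
    ball x (infDist x (frontier Ω)) ⊆ Ω := by
  by_cases hΩ : Ω = univ
  · simp [hΩ]
  · obtain ⟨y, hy, hxy⟩ := exists_mem_frontier_infDist_compl_eq_dist hx hΩ
    refine (ball_subset_ball ?_).trans ball_infDist_compl_subset
    exact hxy ▸ infDist_le_dist_of_mem hy

/-- The projection along a compact set of a closed set is closed. -/
theorem isClosed_exists_mem_of_isCompact {X Y : Type*} [TopologicalSpace X] [TopologicalSpace Y]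
    {K : Set Y} (hK : IsCompact K) {S : Set (X × Y)} (hS : IsClosed S) :
    IsClosed {x | ∃ y ∈ K, (x, y) ∈ S} := by
  have := isCompact_iff_compactSpace.mp hK
  have hS' : IsClosed ((fun p : X × K => (p.1, (p.2 : Y))) ⁻¹' S) := hS.preimage (by fun_prop)
  convert isClosedMap_fst_of_compactSpace _ hS' using 1
  ext x
  simp

section InfConv

variable {n : ℕ} {Ω : Set (En n)} {u : En n → ℝ} {q ε : ℝ}

theorem continuous_infConv_penalty (hq : 2 ≤ q) :
    Continuous fun p : En n × En n => ‖p.1 - p.2‖ ^ q / (q * ε ^ (q - 1)) :=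
  ((continuous_fst.sub continuous_snd).norm.rpow_const fun _ => Or.inr (by linarith)).div_const _

theorem mem_Yset_iff (hbddB : BddBelow (u '' Ω)) (hq : 2 ≤ q) (hε : 0 < ε) {x y : En n} :
    y ∈ Yset u Ω q ε x ↔ y ∈ Ω ∧ ∀ z ∈ Ω,
      u y + ‖x - y‖ ^ q / (q * ε ^ (q - 1)) ≤ u z + ‖x - z‖ ^ q / (q * ε ^ (q - 1)) := by
  have hC : 0 < q * ε ^ (q - 1) := by positivity
  have hbdd : BddBelow ((fun y => u y + ‖x - y‖ ^ q / (q * ε ^ (q - 1))) '' Ω) := by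
    obtain ⟨b, hb⟩ := hbddB
    refine ⟨b, ?_⟩
    rintro _ ⟨z, hz, rfl⟩
    have h1 : b ≤ u z := hb (mem_image_of_mem u hz)
    have h2 : 0 ≤ ‖x - z‖ ^ q / (q * ε ^ (q - 1)) := by positivity
    change b ≤ u z + _
    linarith
  refine and_congr_right fun hy => ⟨fun h z hz => ?_, fun h => ?_⟩
  · rw [← h]
    exact csInf_le hbdd (mem_image_of_mem _ hz)
  · refine IsLeast.csInf_eq ⟨mem_image_of_mem _ hy, ?_⟩
    rintro _ ⟨z, hz, rfl⟩
    exact h z hz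

theorem rEps_nonneg (hbddA : BddAbove (u '' Ω)) (hbddB : BddBelow (u '' Ω))
    (hq : 2 ≤ q) (hε : 0 < ε) : 0 ≤ rEps u Ω q ε := by
  have : 0 ≤ sSup (u '' Ω) - sInf (u '' Ω) := sub_nonneg.2 (Real.sInf_le_sSup _ hbddB hbddA)
  unfold rEps
  positivity

/-- A competitor no worse than `x` itself lies within distance `r(ε)` of `x`. -/
theorem norm_sub_le_rEps (hbddA : BddAbove (u '' Ω)) (hbddB : BddBelow (u '' Ω))
    (hq : 2 ≤ q) (hε : 0 < ε) {x y : En n} (hx : x ∈ Ω) (hy : y ∈ Ω)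
    (h : u y + ‖x - y‖ ^ q / (q * ε ^ (q - 1)) ≤ u x) : ‖x - y‖ ≤ rEps u Ω q ε := by
  have hC : 0 < q * ε ^ (q - 1) := by positivity
  have h1 : u x ≤ sSup (u '' Ω) := le_csSup hbddA (mem_image_of_mem u hx)
  have h2 : sInf (u '' Ω) ≤ u y := csInf_le hbddB (mem_image_of_mem u hy)
  have h3 : ‖x - y‖ ^ q ≤ q * ε ^ (q - 1) * (sSup (u '' Ω) - sInf (u '' Ω)) := by
    rw [← div_le_iff₀' hC]
    linarith
  have hq0 : q ≠ 0 := by linarith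
  calc ‖x - y‖ = (‖x - y‖ ^ q) ^ (1 / q) := by
        rw [one_div, Real.rpow_rpow_inv (norm_nonneg _) hq0]
    _ ≤ rEps u Ω q ε := Real.rpow_le_rpow (by positivity) h3 (by positivity)

theorem norm_sub_le_rEps_of_mem_Yset (hbddA : BddAbove (u '' Ω)) (hbddB : BddBelow (u '' Ω))
    (hq : 2 ≤ q) (hε : 0 < ε) {x y : En n} (hx : x ∈ Ω) (hy : y ∈ Yset u Ω q ε x) :
    ‖y - x‖ ≤ rEps u Ω q ε := by
  obtain ⟨hyΩ, hmin⟩ := (mem_Yset_iff hbddB hq hε).1 hy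
  have h := hmin x hx
  rw [sub_self, norm_zero, Real.zero_rpow (by linarith), zero_div, add_zero] at h
  exact norm_sub_rev y x ▸ norm_sub_le_rEps hbddA hbddB hq hε hx hyΩ h

/-- Over a closed subset of `Ω`, the graph of the minimizer map `Y_ε` is closed. -/
theorem isClosed_graph_Yset (hbddB : BddBelow (u '' Ω)) (hlsc : LowerSemicontinuousOn u Ω)
    (hq : 2 ≤ q) (hε : 0 < ε) {K : Set (En n)} (hK : IsClosed K) (hKΩ : K ⊆ Ω) :
    IsClosed {p : En n × En n | p.2 ∈ K ∧ p.2 ∈ Yset u Ω q ε p.1} := by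
  have hepi := (lowerSemicontinuousOn_iff_isClosed_epigraph hK).1 (hlsc.mono hKΩ)
  have hφ := continuous_infConv_penalty (n := n) (ε := ε) hq
  have hz (z : En n) : IsClosed {p : En n × En n | p.2 ∈ K ∧ u p.2 ≤
      u z + ‖p.1 - z‖ ^ q / (q * ε ^ (q - 1)) - ‖p.1 - p.2‖ ^ q / (q * ε ^ (q - 1))} := by
    refine hepi.preimage (f := fun p : En n × En n => (p.2, u z +
      ‖p.1 - z‖ ^ q / (q * ε ^ (q - 1)) - ‖p.1 - p.2‖ ^ q / (q * ε ^ (q - 1)))) ?_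
    exact continuous_snd.prodMk
      ((continuous_const.add (hφ.comp (continuous_fst.prodMk continuous_const))).sub hφ)
  convert (hK.preimage continuous_snd).inter (isClosed_biInter fun z (_ : z ∈ Ω) => hz z) using 1
  ext p
  simp only [mem_inter_iff, mem_iInter, mem_preimage, mem_ofPred_eq, mem_Yset_iff hbddB hq hε,
    le_sub_iff_add_le]
  exact ⟨fun h => ⟨h.1, fun z hz => ⟨h.1, h.2.2 z hz⟩⟩,
    fun h => ⟨h.1, hKΩ h.1, fun z hz => (h.2 z hz).2⟩⟩

theorem Yset_nonempty (hbddA : BddAbove (u '' Ω)) (hbddB : BddBelow (u '' Ω))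
    (hlsc : LowerSemicontinuousOn u Ω) (hq : 2 ≤ q) (hε : 0 < ε) {x : En n}
    (hx : x ∈ Ω) (hball : closedBall x (rEps u Ω q ε) ⊆ Ω) : (Yset u Ω q ε x).Nonempty := by
  have hxK : x ∈ closedBall x (rEps u Ω q ε) :=
    mem_closedBall_self (rEps_nonneg hbddA hbddB hq hε)
  have hF : LowerSemicontinuousOn (fun y => u y + ‖x - y‖ ^ q / (q * ε ^ (q - 1)))
      (closedBall x (rEps u Ω q ε)) :=
    (hlsc.mono hball).add (((continuous_infConv_penalty hq).comp
      (continuous_const.prodMk continuous_id)).lowerSemicontinuous.lowerSemicontinuousOn _)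
  obtain ⟨y, hyK, hy⟩ := hF.exists_isMinOn ⟨x, hxK⟩ (isCompact_closedBall _ _)
  have hx0 : u x + ‖x - x‖ ^ q / (q * ε ^ (q - 1)) = u x := by
    rw [sub_self, norm_zero, Real.zero_rpow (by linarith), zero_div, add_zero]
  refine ⟨y, (mem_Yset_iff hbddB hq hε).2 ⟨hball hyK, fun z hz => ?_⟩⟩
  by_cases hzK : z ∈ closedBall x (rEps u Ω q ε)
  · exact hy hzK
  · have hyx : u y + ‖x - y‖ ^ q / (q * ε ^ (q - 1)) ≤ u x := (hy hxK).trans_eq hx0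
    refine hyx.trans (le_of_not_ge fun h => hzK ?_)
    rw [mem_closedBall, dist_comm, dist_eq_norm]
    exact norm_sub_le_rEps hbddA hbddB hq hε hx hz h

theorem closedBall_subset_of_mem_innerSet {r : ℝ} {x : En n} (hx : x ∈ innerSet Ω r) :
    closedBall x r ⊆ Ω :=
  (closedBall_subset_ball hx.2).trans (ball_infDist_frontier_subset hx.1)

/-- The supremum of `|y - x|` over `Y_ε(x)` is a maximum. -/
theorem exists_mem_Yset_norm_eq_sSup (hbddA : BddAbove (u '' Ω)) (hbddB : BddBelow (u '' Ω))
    (hlsc : LowerSemicontinuousOn u Ω) (hq : 2 ≤ q) (hε : 0 < ε) {x : En n}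
    (hx : x ∈ innerSet Ω (rEps u Ω q ε)) :
    ∃ y ∈ Yset u Ω q ε x, ‖y - x‖ = sSup ((fun z => ‖z - x‖) '' Yset u Ω q ε x) := by
  have hball := closedBall_subset_of_mem_innerSet hx
  have hYK : Yset u Ω q ε x ⊆ closedBall x (rEps u Ω q ε) := fun y hy =>
    mem_closedBall_iff_norm.2 (norm_sub_le_rEps_of_mem_Yset hbddA hbddB hq hε hx.1 hy)
  have hclosed : IsClosed (Yset u Ω q ε x) := by
    convert (isClosed_graph_Yset hbddB hlsc hq hε isClosed_closedBall hball).preimage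
      (Continuous.prodMk_right x) using 1
    ext y
    exact ⟨fun hy => ⟨hYK hy, hy⟩, fun hy => hy.2⟩
  have hcompact := (isCompact_closedBall x _).of_isClosed_subset hclosed hYK
  obtain ⟨y, hy, hsup, -⟩ := hcompact.exists_sSup_image_eq_and_ge
    (Yset_nonempty hbddA hbddB hlsc hq hε hx.1 hball)
    (f := fun z => ‖z - x‖) (by fun_prop)
  exact ⟨y, hy, hsup.symm⟩

end InfConv

/-- `x ↦ sup_{y ∈ Y_ε(x)} |y - x|` is upper semicontinuous on `Ω_{r(ε)}`
and the supremum is attained. -/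
theorem stmt10
    {n : ℕ} (hn : 1 ≤ n)
    (Ω : Set (En n)) (hΩo : IsOpen Ω) (hΩb : Bornology.IsBounded Ω)
    (u : En n → ℝ)
    (hbddA : BddAbove (u '' Ω)) (hbddB : BddBelow (u '' Ω))
    (hlsc : LowerSemicontinuousOn u Ω)
    (q ε : ℝ) (hq : 2 ≤ q) (hε : 0 < ε) :
    UpperSemicontinuousOn (fun x => sSup ((fun y => ‖y - x‖) '' Yset u Ω q ε x))
      (innerSet Ω (rEps u Ω q ε)) ∧
    ∀ x ∈ innerSet Ω (rEps u Ω q ε), ∃ y ∈ Yset u Ω q ε x,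
      ‖y - x‖ = sSup ((fun z => ‖z - x‖) '' Yset u Ω q ε x) := by
  have hattained := fun x (hx : x ∈ innerSet Ω (rEps u Ω q ε)) =>
    exists_mem_Yset_norm_eq_sSup hbddA hbddB hlsc hq hε hx
  refine ⟨fun x₀ hx₀ c hc => ?_, hattained⟩
  obtain ⟨ρ, hrρ, hρ⟩ := exists_between hx₀.2
  have hKΩ : closedBall x₀ ρ ⊆ Ω :=
    (closedBall_subset_ball hρ).trans (ball_infDist_frontier_subset hx₀.1)
  have hclosed : IsClosed {x | ∃ y ∈ closedBall x₀ ρ, (x, y) ∈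
      {p : En n × En n | p.2 ∈ closedBall x₀ ρ ∧ p.2 ∈ Yset u Ω q ε p.1} ∩
        {p | c ≤ ‖p.2 - p.1‖}} :=
    isClosed_exists_mem_of_isCompact (isCompact_closedBall _ _)
      ((isClosed_graph_Yset hbddB hlsc hq hε isClosed_closedBall hKΩ).inter
        (isClosed_le continuous_const (by fun_prop)))
  have hx₀_notMem : x₀ ∉ {x | ∃ y ∈ closedBall x₀ ρ, (x, y) ∈
      {p : En n × En n | p.2 ∈ closedBall x₀ ρ ∧ p.2 ∈ Yset u Ω q ε p.1} ∩
        {p | c ≤ ‖p.2 - p.1‖}} := by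
    rintro ⟨y, -, ⟨-, hy⟩, hcy⟩
    refine (hcy.trans (le_csSup ⟨rEps u Ω q ε, ?_⟩ (mem_image_of_mem _ hy))).not_gt hc
    rintro _ ⟨z, hz, rfl⟩
    exact norm_sub_le_rEps_of_mem_Yset hbddA hbddB hq hε hx₀.1 hz
  filter_upwards [self_mem_nhdsWithin,
    mem_nhdsWithin_of_mem_nhds (hclosed.isOpen_compl.mem_nhds hx₀_notMem),
    mem_nhdsWithin_of_mem_nhds (ball_mem_nhds x₀ (sub_pos.2 hrρ))] with x hx hxc hxb
  obtain ⟨y, hy, hysup⟩ := hattained x hx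
  have hyx := norm_sub_le_rEps_of_mem_Yset hbddA hbddB hq hε hx.1 hy
  have hyK : y ∈ closedBall x₀ ρ := by
    rw [mem_closedBall]
    rw [mem_ball] at hxb
    rw [← dist_eq_norm] at hyx
    linarith [dist_triangle y x x₀]
  change sSup ((fun z => ‖z - x‖) '' Yset u Ω q ε x) < c
  rw [← hysup]
  exact lt_of_not_ge fun h => hxc ⟨y, hyK, ⟨hyK, hy⟩, h⟩
end
end
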